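/- Let (X,T) be a topological dynamical system, f ∈ C(X,ℝ), and μ an ergodic T-invariant Borel probability measure with h_μ(T) > 0. Then for μ-almost every x ∈ X there exists a closed subset A(x) ⊆ W^s(x,T) such that lim_{n→∞} diam(T^n A(x)) = 0 and P(T^{-1},f,A(x)) ≥ P_μ(T,f). -/

import Mathlib

open Filter Set Topology MeasureTheory

noncomputable section

variable {X : Type*}

/-- Birkhoff sum `f_n(x) = ∑_{j<n} f(T^j x)`. -/
def birk (T : X → X) (f : X → ℝ) (n : ℕ) (x : X) : ℝ :=
  ∑ j ∈ Finset.range n, f (T^[j] x)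

/-- `P_n(T,f,δ,K)`: supremum of `∑_{x∈E} exp f_n(x)` over `(n,δ)`-separated
subsets `E ⊆ K`. -/
def sepPn [MetricSpace X] (T : X → X) (f : X → ℝ) (n : ℕ) (δ : ℝ) (K : Set X) : ℝ :=
  sSup { r : ℝ | ∃ E : Finset X, ↑E ⊆ K ∧
    (∀ x ∈ E, ∀ y ∈ E, x ≠ y → ∃ i < n, δ < dist (T^[i] x) (T^[i] y)) ∧
    r = ∑ x ∈ E, Real.exp (birk T f n x) }

/-- The topological pressure of `T` for the subset `K`:
`P(T,f,K) = lim_{δ→0} limsup_n (1/n) log P_n(T,f,δ,K)`; since the expression is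
nonincreasing in `δ`, the limit is the supremum over `δ > 0`. -/
def pres [MetricSpace X] (T : X → X) (f : X → ℝ) (K : Set X) : EReal :=
  ⨆ (δ : ℝ) (_ : 0 < δ), atTop.limsup fun n : ℕ =>
    ((Real.log (sepPn T f n δ K) / n : ℝ) : EReal)

/-- The `ε`-stable set `W^s_ε(x,T)`. -/
def epsStable [MetricSpace X] (T : X → X) (ε : ℝ) (x : X) : Set X :=
  { y | ∀ n : ℕ, dist (T^[n] x) (T^[n] y) ≤ ε }

/-- The topological pressure of the preimages of the `ε`-stable set of `x`:
`P_s(T,f,x,ε) = lim_{δ→0} limsup_n (1/n) log P_n(T,f,δ,T^{-n}W^s_ε(x,T))`. -/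
def Ps [MetricSpace X] (T : X → X) (f : X → ℝ) (x : X) (ε : ℝ) : EReal :=
  ⨆ (δ : ℝ) (_ : 0 < δ), atTop.limsup fun n : ℕ =>
    ((Real.log (sepPn T f n δ ((T^[n]) ⁻¹' epsStable T ε x)) / n : ℝ) : EReal)

/-- A finite open cover of `X`. -/
def IsOpenCover [TopologicalSpace X] (𝒰 : Finset (Set X)) : Prop :=
  (∀ U ∈ 𝒰, IsOpen U) ∧ ⋃₀ (𝒰 : Set (Set X)) = univ

/-- A finite Borel cover of `X`. -/
def IsBorelCover [MeasurableSpace X] (𝒱 : Finset (Set X)) : Prop :=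
  (∀ V ∈ 𝒱, MeasurableSet V) ∧ ⋃₀ (𝒱 : Set (Set X)) = univ

/-- `𝒱` refines the iterated cover `𝒰_0^{n-1} = ⋁_{i<n} T^{-i}𝒰`. -/
def RefinesIter (T : X → X) (𝒰 : Finset (Set X)) (n : ℕ) (𝒱 : Finset (Set X)) : Prop :=
  ∀ V ∈ 𝒱, ∃ g : Fin n → Set X, (∀ i, g i ∈ 𝒰) ∧ V ⊆ ⋂ i : Fin n, (T^[(i : ℕ)]) ⁻¹' g i

/-- `P_n(T,f,𝒰,K)`: infimum over finite Borel covers `𝒱` refining `𝒰_0^{n-1}` of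
`∑_{V∈𝒱} sup_{x ∈ V∩K} exp f_n(x)` (an empty summand contributes `0`, which is
`Real.sSup ∅`). -/
def covPn [MeasurableSpace X] (T : X → X) (f : X → ℝ) (𝒰 : Finset (Set X)) (n : ℕ)
    (K : Set X) : ℝ :=
  sInf { r : ℝ | ∃ 𝒱 : Finset (Set X), IsBorelCover 𝒱 ∧ RefinesIter T 𝒰 n 𝒱 ∧
    r = ∑ V ∈ 𝒱, sSup ((fun x => Real.exp (birk T f n x)) '' (V ∩ K)) }

/-- A finite Borel partition of `X`. -/
def IsFinPartition [MeasurableSpace X] (α : Finset (Set X)) : Prop :=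
  (∀ A ∈ α, MeasurableSet A) ∧ ⋃₀ (α : Set (Set X)) = univ ∧
    (α : Set (Set X)).Pairwise Disjoint

/-- `H_μ(⋁_{i<n} T^{-i}α)`, computed over all atoms `⋂_{i<n} T^{-i} A_i`. -/
def dynH [MeasurableSpace X] (μ : Measure X) (T : X → X) (α : Finset (Set X)) (n : ℕ) : ℝ :=
  ∑ g : Fin n → α, Real.negMulLog ((μ (⋂ i : Fin n, (T^[(i : ℕ)]) ⁻¹' (g i : Set X))).toReal)

/-- `h_μ(T,α) = lim_n (1/n) H_μ(α_0^{n-1})`, which for an invariant measure equals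
the infimum of `(1/n) H_μ(α_0^{n-1})` over `n ≥ 1`. -/
def entPart [MeasurableSpace X] (μ : Measure X) (T : X → X) (α : Finset (Set X)) : ℝ :=
  ⨅ n : ℕ, dynH μ T α (n + 1) / (n + 1 : ℝ)

/-- The measure-theoretic entropy `h_μ(T)`. -/
def mEnt [MeasurableSpace X] (μ : Measure X) (T : X → X) : EReal :=
  ⨆ (α : Finset (Set X)) (_ : IsFinPartition α), ((entPart μ T α : ℝ) : EReal)

/-- The measure-theoretic pressure `P_μ(T,f) = h_μ(T) + ∫ f dμ`. -/
def mPres [MeasurableSpace X] (μ : Measure X) (T : X → X) (f : X → ℝ) : EReal :=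
  mEnt μ T + ((∫ x, f x ∂μ : ℝ) : EReal)

/-- The stable set `W^s(x,T)`. -/
def stableSet [MetricSpace X] (T : X → X) (x : X) : Set X :=
  { y | Tendsto (fun n : ℕ => dist (T^[n] x) (T^[n] y)) atTop (𝓝 0) }

/-- A Cantor set: a nonempty compact perfect totally disconnected set. -/
def IsCantorSet [TopologicalSpace X] (C : Set X) : Prop :=
  C.Nonempty ∧ IsCompact C ∧ Perfect C ∧ IsTotallyDisconnected C

/-- A weakly mixing set for `T`. -/
def IsWeaklyMixingSet [TopologicalSpace X] (T : X → X) (A : Set X) : Prop :=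
  A.Nonempty ∧ IsClosed A ∧
  ∃ B : Set X, B ⊆ A ∧
    (∃ C : ℕ → Set X, (∀ n, IsCantorSet (C n)) ∧ B = ⋃ n, C n) ∧
    closure B = A ∧
    ∀ C : Set X, C ⊆ B → IsCantorSet C →
      ∀ g : C → X, Continuous g → (∀ c : C, g c ∈ A) →
        ∃ φ : ℕ → ℕ, StrictMono φ ∧
          ∀ c : C, Tendsto (fun i => T^[φ i] (c : X)) atTop (𝓝 (g c))

/-- Translation by `t` of the second coordinate of an index `(row, time)`. -/
def timeShift (t : ℤ) : ℕ × ℤ ≃ ℕ × ℤ :=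
  Equiv.prodCongr (Equiv.refl ℕ) (Equiv.addRight t)

/-- The properties of the joint entropy of finite subfamilies of a stationary family indexed
by `ℕ × ℤ` that follow from Shannon's inequalities. -/
structure IsEntropyFn (F : Finset (ℕ × ℤ) → ℝ) : Prop where
  empty : F ∅ = 0
  mono : ∀ A B, A ⊆ B → F A ≤ F B
  submod : ∀ A B, F (A ∪ B) + F (A ∩ B) ≤ F A + F B
  shift : ∀ t A, F (A.map (timeShift t).toEmbedding) = F A

/-- Conditional entropy of the finite family `A` given the possibly infinite family `B`. -/
def condF (F : Finset (ℕ × ℤ) → ℝ) (A : Finset (ℕ × ℤ)) (B : Set (ℕ × ℤ)) : ℝ :=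
  ⨅ C : {C : Finset (ℕ × ℤ) // (C : Set (ℕ × ℤ)) ⊆ B}, (F (A ∪ C) - F C)

/-- All translates of `D` by nonnegative times. -/
def ray (D : Finset (ℕ × ℤ)) : Set (ℕ × ℤ) := {s | ∃ t : ℕ, (s.1, s.2 - t) ∈ D}

/-- The union of the translates of `D` by the times `-1, …, -n`. -/
def seg (D : Finset (ℕ × ℤ)) (n : ℕ) : Finset (ℕ × ℤ) :=
  (Finset.range n).biUnion fun i => D.map (timeShift (-(i + 1 : ℤ))).toEmbedding

lemma mem_map_timeShift {t : ℤ} {A : Finset (ℕ × ℤ)} {s : ℕ × ℤ} :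
    s ∈ A.map (timeShift t).toEmbedding ↔ (s.1, s.2 - t) ∈ A := by
  rw [Finset.mem_map_equiv]
  simp only [timeShift, sub_eq_add_neg]; rfl

lemma mem_image_timeShift {t : ℤ} {A : Set (ℕ × ℤ)} {s : ℕ × ℤ} :
    s ∈ timeShift t '' A ↔ (s.1, s.2 - t) ∈ A := by
  rw [Equiv.image_eq_preimage_symm]
  simp only [timeShift, sub_eq_add_neg]; rfl

lemma mem_seg {D : Finset (ℕ × ℤ)} {n : ℕ} {s : ℕ × ℤ} :
    s ∈ seg D n ↔ ∃ i < n, (s.1, s.2 + (i + 1 : ℤ)) ∈ D := by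
  simp only [seg, Finset.mem_biUnion, Finset.mem_range, mem_map_timeShift, sub_neg_eq_add]

lemma mem_ray {D : Finset (ℕ × ℤ)} {s : ℕ × ℤ} :
    s ∈ ray D ↔ ∃ t : ℕ, (s.1, s.2 - t) ∈ D := Iff.rfl

lemma ray_mono {D E : Finset (ℕ × ℤ)} (h : D ⊆ E) : ray D ⊆ ray E :=
  fun _ ⟨t, ht⟩ => ⟨t, h ht⟩

lemma ray_union (D E : Finset (ℕ × ℤ)) : ray (D ∪ E) = ray D ∪ ray E := by
  ext s; simp only [mem_ray, Finset.mem_union, Set.mem_union, exists_or]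

lemma seg_union (D E : Finset (ℕ × ℤ)) (n : ℕ) : seg (D ∪ E) n = seg D n ∪ seg E n := by
  ext s
  simp only [mem_seg, Finset.mem_union, ← exists_or, ← and_or_left]

lemma seg_succ (D : Finset (ℕ × ℤ)) (n : ℕ) :
    seg D (n + 1) = seg D n ∪ D.map (timeShift (-(n + 1 : ℤ))).toEmbedding := by
  rw [seg, Finset.range_add_one, Finset.biUnion_insert, Finset.union_comm]; rfl

lemma seg_union_ray (D : Finset (ℕ × ℤ)) (n : ℕ) :
    (seg D n : Set (ℕ × ℤ)) ∪ ray D = timeShift (-n) '' ray D := by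
  ext ⟨a, t⟩
  simp only [Set.mem_union, Finset.mem_coe, mem_seg, mem_ray, mem_image_timeShift, sub_neg_eq_add]
  constructor
  · rintro (⟨i, hi, h⟩ | ⟨u, h⟩)
    · refine ⟨n - (i + 1), ?_⟩
      rwa [show t + n - ((n - (i + 1) : ℕ) : ℤ) = t + (i + 1) by omega]
    · refine ⟨u + n, ?_⟩
      rwa [show t + n - ((u + n : ℕ) : ℤ) = t - u by omega]
  · rintro ⟨u, h⟩
    by_cases hu : u < n
    · refine Or.inl ⟨n - (u + 1), by omega, ?_⟩
      rwa [show t + (((n - (u + 1) : ℕ) : ℤ) + 1) = t + n - u by omega]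
    · refine Or.inr ⟨u - n, ?_⟩
      rwa [show t - ((u - n : ℕ) : ℤ) = t + n - u by omega]

namespace IsEntropyFn

variable {F : Finset (ℕ × ℤ) → ℝ} (hF : IsEntropyFn F)
include hF

lemma diff_anti (A : Finset (ℕ × ℤ)) {B C : Finset (ℕ × ℤ)} (h : B ⊆ C) :
    F (A ∪ C) - F C ≤ F (A ∪ B) - F B := by
  have h1 := hF.submod (A ∪ B) C
  have h2 : A ∪ B ∪ C = A ∪ C := by
    rw [Finset.union_assoc, Finset.union_eq_right.2 h]
  have h3 := hF.mono B ((A ∪ B) ∩ C) (Finset.subset_inter Finset.subset_union_right h)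
  rw [h2] at h1
  linarith

lemma diff_nonneg (A B : Finset (ℕ × ℤ)) : 0 ≤ F (A ∪ B) - F B :=
  sub_nonneg.2 (hF.mono _ _ Finset.subset_union_right)

lemma condF_bddBelow (A : Finset (ℕ × ℤ)) (B : Set (ℕ × ℤ)) :
    BddBelow (Set.range fun C : {C : Finset (ℕ × ℤ) // (C : Set (ℕ × ℤ)) ⊆ B} =>
      F (A ∪ C) - F C) :=
  ⟨0, by rintro _ ⟨C, rfl⟩; exact hF.diff_nonneg _ _⟩

omit hF in
lemma le_condF {A : Finset (ℕ × ℤ)} {B : Set (ℕ × ℤ)} {c : ℝ}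
    (h : ∀ C : Finset (ℕ × ℤ), (C : Set (ℕ × ℤ)) ⊆ B → c ≤ F (A ∪ C) - F C) :
    c ≤ condF F A B := by
  have : Nonempty {C : Finset (ℕ × ℤ) // (C : Set (ℕ × ℤ)) ⊆ B} := ⟨⟨∅, by simp⟩⟩
  exact le_ciInf fun C => h C.1 C.2

lemma condF_le {A : Finset (ℕ × ℤ)} {B : Set (ℕ × ℤ)} {C : Finset (ℕ × ℤ)}
    (h : (C : Set (ℕ × ℤ)) ⊆ B) : condF F A B ≤ F (A ∪ C) - F C :=
  ciInf_le (hF.condF_bddBelow A B) ⟨C, h⟩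

lemma condF_anti (A : Finset (ℕ × ℤ)) {B C : Set (ℕ × ℤ)} (h : B ⊆ C) :
    condF F A C ≤ condF F A B :=
  le_condF fun _ hD => hF.condF_le (hD.trans h)

lemma condF_tendsto (A : Finset (ℕ × ℤ)) (B : Set (ℕ × ℤ)) :
    Tendsto (fun C : {C : Finset (ℕ × ℤ) // (C : Set (ℕ × ℤ)) ⊆ B} => F (A ∪ C) - F C)
      atTop (𝓝 (condF F A B)) :=
  tendsto_atTop_ciInf (fun _ _ h => hF.diff_anti A h) (hF.condF_bddBelow A B)

lemma condF_chain (A A' : Finset (ℕ × ℤ)) (B : Set (ℕ × ℤ)) :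
    condF F (A ∪ A') B = condF F A B + condF F A' (A ∪ B) := by
  classical
  have : Nonempty {C : Finset (ℕ × ℤ) // (C : Set (ℕ × ℤ)) ⊆ B} := ⟨⟨∅, by simp⟩⟩
  have : IsDirected {C : Finset (ℕ × ℤ) // (C : Set (ℕ × ℤ)) ⊆ B} (· ≤ ·) :=
    ⟨fun C D => ⟨⟨C.1 ∪ D.1, by simpa using ⟨C.2, D.2⟩⟩,
      Finset.subset_union_left, Finset.subset_union_right⟩⟩
  let φ : {C : Finset (ℕ × ℤ) // (C : Set (ℕ × ℤ)) ⊆ B} →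
      {C : Finset (ℕ × ℤ) // (C : Set (ℕ × ℤ)) ⊆ (A : Set (ℕ × ℤ)) ∪ B} :=
    fun C => ⟨A ∪ C.1, by
      rw [Finset.coe_union]; exact Set.union_subset_union_right _ C.2⟩
  have hφ : Tendsto φ atTop atTop := by
    refine tendsto_atTop_atTop_of_monotone (fun C D h => Finset.union_subset_union_right h) ?_
    intro C
    refine ⟨⟨C.1.filter (· ∈ B), fun x hx => (Finset.mem_filter.1 hx).2⟩, fun x hx => ?_⟩
    rcases C.2 hx with h | h
    · exact Finset.mem_union_left _ h
    · exact Finset.mem_union_right _ (Finset.mem_filter.2 ⟨hx, h⟩)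
  refine tendsto_nhds_unique (hF.condF_tendsto (A ∪ A') B) ?_
  refine ((hF.condF_tendsto A B).add ((hF.condF_tendsto A' (A ∪ B)).comp hφ)).congr fun C => ?_
  simp only [Function.comp, φ]
  rw [show A' ∪ (A ∪ C.1) = A ∪ A' ∪ C.1 by
    rw [← Finset.union_assoc, Finset.union_comm A' A]]
  ring

lemma condF_shift_le (t : ℤ) (A : Finset (ℕ × ℤ)) (B : Set (ℕ × ℤ)) :
    condF F (A.map (timeShift t).toEmbedding) (timeShift t '' B) ≤ condF F A B := by
  refine le_condF fun C hC => ?_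
  refine (hF.condF_le (C := C.map (timeShift t).toEmbedding) ?_).trans ?_
  · rw [Finset.coe_map]; exact Set.image_mono hC
  · rw [← Finset.map_union, hF.shift, hF.shift]

lemma condF_shift (t : ℤ) (A : Finset (ℕ × ℤ)) (B : Set (ℕ × ℤ)) :
    condF F (A.map (timeShift t).toEmbedding) (timeShift t '' B) = condF F A B := by
  refine le_antisymm (hF.condF_shift_le t A B) ?_
  have h := hF.condF_shift_le (-t) (A.map (timeShift t).toEmbedding) (timeShift t '' B)
  have e1 : (A.map (timeShift t).toEmbedding).map (timeShift (-t)).toEmbedding = A := by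
    ext s; simp only [mem_map_timeShift]; simp
  have e2 : timeShift (-t) '' (timeShift t '' B) = B := by
    ext s; simp only [mem_image_timeShift]; simp
  rwa [e1, e2] at h

/-- The entropy of the block `D` at time `-1` given the future of `D` and a further family. -/
lemma condF_seg (D : Finset (ℕ × ℤ)) (S : Set (ℕ × ℤ)) (n : ℕ) :
    condF F (seg D n) (ray D ∪ S) = ∑ k ∈ Finset.range n,
      condF F (D.map (timeShift (-1)).toEmbedding) (ray D ∪ timeShift k '' S) := by
  induction n with
  | zero =>
    refine le_antisymm ?_ ?_
    · simpa [seg] using hF.condF_le (A := ∅) (B := ray D ∪ S) (C := ∅) (by simp)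
    · exact le_condF fun C _ => by simp [seg]
  | succ n ih =>
    rw [seg_succ, hF.condF_chain, ih, Finset.sum_range_succ, add_right_inj, ← Set.union_assoc,
      seg_union_ray,
      ← hF.condF_shift n (D.map (timeShift (-(n + 1 : ℤ))).toEmbedding)]
    congr 1
    · ext s
      simp only [mem_map_timeShift]
      rw [show s.2 - n - -((n : ℤ) + 1) = s.2 - -1 by ring]
    · ext s
      simp only [mem_image_timeShift, Set.mem_union, sub_neg_eq_add, sub_add_cancel]

lemma tendsto_seg_div (D : Finset (ℕ × ℤ)) :
    Tendsto (fun n : ℕ => F (seg D n) / n) atTop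
      (𝓝 (condF F (D.map (timeShift (-1)).toEmbedding) (ray D))) := by
  have hstep : ∀ n, F (seg D (n + 1)) - F (seg D n) =
      F (D.map (timeShift (-1)).toEmbedding ∪ (seg D n).map (timeShift n).toEmbedding) -
        F ((seg D n).map (timeShift n).toEmbedding) := by
    intro n
    rw [hF.shift, ← hF.shift n (seg D (n + 1))]
    congr 2
    ext s
    rw [seg_succ, mem_map_timeShift, Finset.mem_union, Finset.mem_union, mem_map_timeShift,
      mem_map_timeShift, mem_map_timeShift, or_comm]
    simp only
    rw [show s.2 - n - -((n : ℤ) + 1) = s.2 - -1 by ring]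
  have hlim : Tendsto (fun n => F (seg D (n + 1)) - F (seg D n)) atTop
      (𝓝 (condF F (D.map (timeShift (-1)).toEmbedding) (ray D))) := by
    have hsub : ∀ n : ℕ, (((seg D n).map (timeShift n).toEmbedding : Finset (ℕ × ℤ)) :
        Set (ℕ × ℤ)) ⊆ ray D := by
      intro n s hs
      rw [Finset.mem_coe, mem_map_timeShift, mem_seg] at hs
      obtain ⟨i, hi, h⟩ := hs
      refine ⟨n - (i + 1), ?_⟩
      simp only at h
      rwa [show s.2 - ((n - (i + 1) : ℕ) : ℤ) = s.2 - n + (i + 1) by omega]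
    let φ : ℕ → {C : Finset (ℕ × ℤ) // (C : Set (ℕ × ℤ)) ⊆ ray D} := fun n => ⟨_, hsub n⟩
    have hmono : Monotone φ := by
      intro a b hab s hs
      simp only [φ, mem_map_timeShift, mem_seg] at hs ⊢
      obtain ⟨i, hi, h⟩ := hs
      refine ⟨i + (b - a), by omega, ?_⟩
      rwa [show s.2 - b + (((i + (b - a) : ℕ) : ℤ) + 1) = s.2 - a + (i + 1) by omega]
    have hcof : Tendsto φ atTop atTop := by
      refine tendsto_atTop_atTop_of_monotone hmono fun C => ?_
      have h1 : ∀ s ∈ C.1, ∃ t : ℕ, (s.1, s.2 - t) ∈ D := fun s hs => C.2 hs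
      choose! τ hτ using h1
      refine ⟨C.1.sup τ + 1, fun s hs => ?_⟩
      simp only [φ, mem_map_timeShift, mem_seg]
      have h2 : τ s ≤ C.1.sup τ := Finset.le_sup hs
      refine ⟨C.1.sup τ - τ s, by omega, ?_⟩
      have := hτ s hs
      rwa [show s.2 - ((C.1.sup τ + 1 : ℕ) : ℤ) + (((C.1.sup τ - τ s : ℕ) : ℤ) + 1) =
        s.2 - τ s by omega]
    refine ((hF.condF_tendsto _ (ray D)).comp hcof).congr fun n => ?_
    rw [hstep]; rfl
  refine hlim.cesaro.congr fun n => ?_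
  rw [Finset.sum_range_sub (fun n => F (seg D n))]
  have : F (seg D 0) = 0 := by simp [seg, hF.empty]
  rw [this, sub_zero, div_eq_inv_mul]

lemma tendsto_condF_ray (D R : Finset (ℕ × ℤ)) :
    Tendsto (fun k : ℕ => condF F (D.map (timeShift (-1)).toEmbedding)
      (ray D ∪ timeShift k '' ray R)) atTop
      (𝓝 (condF F (D.map (timeShift (-1)).toEmbedding) (ray D))) := by
  set a : ℕ → ℝ := fun k => condF F (D.map (timeShift (-1)).toEmbedding)
      (ray D ∪ timeShift k '' ray R) with ha
  set H := condF F (D.map (timeShift (-1)).toEmbedding) (ray D) with hH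
  have hmono : Monotone a := by
    intro i j hij
    refine hF.condF_anti _ (Set.union_subset_union_right _ fun s hs => ?_)
    rw [mem_image_timeShift] at hs ⊢
    obtain ⟨t, ht⟩ := hs
    refine ⟨t + (j - i), ?_⟩
    simp only at ht ⊢
    rwa [show s.2 - i - ((t + (j - i) : ℕ) : ℤ) = s.2 - j - t by omega]
  have hle : ∀ k, a k ≤ H := fun k => hF.condF_anti _ Set.subset_union_left
  obtain ⟨l, hl⟩ : ∃ l, Tendsto a atTop (𝓝 l) :=
    ⟨_, tendsto_atTop_ciSup hmono ⟨H, by rintro _ ⟨k, rfl⟩; exact hle k⟩⟩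
  have hlH : l ≤ H := le_of_tendsto' hl hle
  set H' := condF F ((D ∪ R).map (timeShift (-1)).toEmbedding) (ray (D ∪ R)) with hH'
  have key : ∀ n : ℕ, n * H' - F (seg (D ∪ R) n) + F (seg D n) ≤
      ∑ k ∈ Finset.range n, a k := by
    intro n
    have h1 := hF.condF_seg D (ray R) n
    have h2 := hF.condF_seg (D ∪ R) ∅ n
    simp only [Set.image_empty, Set.union_empty, Finset.sum_const, Finset.card_range,
      nsmul_eq_mul] at h2
    rw [seg_union, hF.condF_chain, ray_union, h1] at h2
    have h3 : condF F (seg R n) (seg D n ∪ (ray D ∪ ray R)) ≤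
        F (seg R n ∪ seg D n) - F (seg D n) := hF.condF_le Set.subset_union_left
    rw [Finset.union_comm] at h3
    rw [hH', ray_union, seg_union]
    linarith
  have hlim : Tendsto (fun n : ℕ => H' - F (seg (D ∪ R) n) / n + F (seg D n) / n) atTop
      (𝓝 (H' - H' + H)) :=
    (tendsto_const_nhds.sub (hF.tendsto_seg_div (D ∪ R))).add (hF.tendsto_seg_div D)
  have hHl : H' - H' + H ≤ l := by
    refine le_of_tendsto_of_tendsto hlim hl.cesaro ?_
    filter_upwards [eventually_gt_atTop 0] with n hn
    have hn' : (0 : ℝ) < n := by exact_mod_cast hn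
    rw [inv_mul_eq_div, le_div_iff₀ hn']
    have := key n
    field_simp
    linarith
  rw [show l = H by linarith] at hl
  exact hl

lemma exists_condF_ray_ge (D R A : Finset (ℕ × ℤ))
    (hA : A ⊆ D.map (timeShift (-1)).toEmbedding) {ε : ℝ} (hε : 0 < ε) :
    ∃ K : ℕ, ∀ k : ℕ, K ≤ k →
      condF F A (ray D) - ε ≤ condF F A (ray D ∪ timeShift k '' ray R) := by
  have h := (hF.tendsto_condF_ray D R).eventually (lt_mem_nhds (sub_lt_self _ hε))
  obtain ⟨K, hK⟩ := eventually_atTop.1 h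
  refine ⟨K, fun k hk => ?_⟩
  have h0 := hK k hk
  have h1 := hF.condF_chain A (D.map (timeShift (-1)).toEmbedding) (ray D)
  have h2 := hF.condF_chain A (D.map (timeShift (-1)).toEmbedding)
    (ray D ∪ timeShift k '' ray R)
  rw [Finset.union_eq_right.2 hA] at h1 h2
  have h3 := hF.condF_anti (D.map (timeShift (-1)).toEmbedding)
    (B := A ∪ ray D) (C := A ∪ (ray D ∪ timeShift k '' ray R))
    (Set.union_subset_union_right _ Set.subset_union_left)
  linarith

end IsEntropyFn

/-- The indices `(0, 0), …, (m, 0)`. -/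
def row (m : ℕ) : Finset (ℕ × ℤ) := Finset.range (m + 1) ×ˢ {0}

lemma mem_row {m : ℕ} {s : ℕ × ℤ} : s ∈ row m ↔ s.1 ≤ m ∧ s.2 = 0 := by
  simp only [row, Finset.mem_product, Finset.mem_range, Nat.lt_succ_iff, Finset.mem_singleton]

/-- The entropy rate of the first `m + 1` rows. -/
def rowRate (F : Finset (ℕ × ℤ) → ℝ) (m : ℕ) : ℝ :=
  condF F ((row m).map (timeShift (-1)).toEmbedding) (ray (row m))

namespace IsEntropyFn

variable {F : Finset (ℕ × ℤ) → ℝ} (hF : IsEntropyFn F)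
include hF

lemma exists_start (D : Finset (ℕ × ℤ)) (j : ℕ) :
    ∃ k : ℕ, ∀ m ≤ j, condF F ((row m).map (timeShift (-1)).toEmbedding) (ray (row m ∪ D)) -
        (1 / 2) ^ (j + 1) ≤
      condF F ((row m).map (timeShift (-1)).toEmbedding)
        (ray (row m ∪ insert (j + 1, (k : ℤ)) D)) := by
  have h : ∀ m, ∃ K : ℕ, ∀ k : ℕ, K ≤ k → _ := fun m =>
    hF.exists_condF_ray_ge (row m ∪ D) {(j + 1, 0)} ((row m).map (timeShift (-1)).toEmbedding)
      (Finset.map_subset_map.2 Finset.subset_union_left)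
      (ε := (1 / 2) ^ (j + 1)) (by positivity)
  choose K hK using h
  refine ⟨(Finset.range (j + 1)).sup K, fun m hm => ?_⟩
  refine (hK m _ (Finset.le_sup (f := K) (Finset.mem_range.2 (Nat.lt_succ_of_le hm)))).trans
    (le_of_eq ?_)
  congr 1
  ext s
  simp only [Set.mem_union, mem_ray, mem_image_timeShift, Finset.mem_union, Finset.mem_insert,
    Finset.mem_singleton, Prod.ext_iff, ← exists_or]
  refine exists_congr fun t => ?_
  have : s.2 - ((Finset.range (j + 1)).sup K : ℕ) - t = 0 ↔
    s.2 - t = ((Finset.range (j + 1)).sup K : ℕ) := by omega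
  simp only [this]
  tauto

/-- There is a family of indices that contains a neighbourhood of `+∞` in each row, is stable under
the time shift, and given which each row keeps almost all its entropy. -/
theorem exists_future : ∃ G : Set (ℕ × ℤ),
    (∀ s ∈ G, (s.1, s.2 + 1) ∈ G) ∧
    (∀ i, ∃ k : ℕ, ∀ t : ℤ, k ≤ t → (i, t) ∈ G) ∧
    ∀ m n : ℕ, n * (rowRate F m - (1 / 2) ^ m) ≤ condF F (seg (row m) n) G := by
  choose k hk using fun (D : Finset (ℕ × ℤ)) (j : ℕ) => hF.exists_start D j
  let D : ℕ → Finset (ℕ × ℤ) := fun j =>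
    Nat.rec {(0, 0)} (fun j D => insert (j + 1, (k D j : ℤ)) D) j
  have hDs : ∀ j, D (j + 1) = insert (j + 1, (k (D j) j : ℤ)) (D j) := fun j => rfl
  have hDmono : Monotone D := monotone_nat_of_le_succ fun j => by
    rw [hDs]; exact Finset.subset_insert _ _
  have hDm : ∀ j, ∀ s ∈ D j, s.1 ≤ j ∧ 0 ≤ s.2 := by
    intro j
    induction j with
    | zero => intro s hs; rw [Finset.mem_singleton.1 hs]; simp
    | succ j ih =>
      intro s hs
      rw [hDs, Finset.mem_insert] at hs
      rcases hs with rfl | hs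
      · simp
      · exact ⟨(ih s hs).1.trans (Nat.le_succ _), (ih s hs).2⟩
  let G : Set (ℕ × ℤ) := ⋃ j, ray (D j)
  have hGs : ∀ s ∈ G, ∀ n : ℕ, (s.1, s.2 + n) ∈ G := by
    intro s hs n
    obtain ⟨j, t, ht⟩ := Set.mem_iUnion.1 hs
    refine Set.mem_iUnion.2 ⟨j, t + n, ?_⟩
    simp only
    rwa [show s.2 + n - ((t + n : ℕ) : ℤ) = s.2 - t by push_cast; ring]
  refine ⟨G, fun s hs => by simpa using hGs s hs 1, fun i => ?_, fun m n => ?_⟩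
  · obtain ⟨k, hk⟩ : ∃ k : ℕ, (i, (k : ℤ)) ∈ D i := by
      cases i with
      | zero => exact ⟨0, by simp [D]⟩
      | succ i => exact ⟨k (D i) i, by rw [hDs]; exact Finset.mem_insert_self _ _⟩
    refine ⟨k, fun t ht => Set.mem_iUnion.2 ⟨i, (t - k).toNat, ?_⟩⟩
    simp only
    rwa [Int.toNat_of_nonneg (by omega), sub_sub_cancel]
  · set A := (row m).map (timeShift (-1)).toEmbedding with hA
    have hb : ∀ j, rowRate F m - (1 / 2) ^ m + (1 / 2) ^ (m + j) ≤
        condF F A (ray (row m ∪ D (m + j))) := by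
      intro j
      induction j with
      | zero =>
        have : ray (row m ∪ D m) = ray (row m) := by
          refine subset_antisymm ?_ (ray_mono Finset.subset_union_left)
          rw [ray_union]
          refine Set.union_subset subset_rfl ?_
          rintro s ⟨t, ht⟩
          have h2 := hDm _ _ ht
          simp only at h2
          refine ⟨t + (s.2 - t).toNat, ?_⟩
          rw [mem_row]
          refine ⟨h2.1, ?_⟩
          simp only
          omega
        simp only [add_zero, this, sub_add_cancel]
        exact le_rfl
      | succ j ih =>
        have h1 := hk (D (m + j)) (m + j) m (Nat.le_add_right _ _)
        rw [← hDs] at h1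
        have h2 : ((1 : ℝ) / 2) ^ (m + j) = 2 * (1 / 2) ^ (m + j + 1) := by
          rw [pow_succ]; ring
        rw [← add_assoc]
        linarith
    have hone : rowRate F m - (1 / 2) ^ m ≤ condF F A (ray (row m) ∪ G) := by
      refine le_condF fun C hC => ?_
      obtain ⟨j, hj⟩ : ∃ j, (C : Set (ℕ × ℤ)) ⊆ ray (row m ∪ D (m + j)) := by
        have h1 : (C : Set (ℕ × ℤ)) ⊆ ⋃ j, ray (row m ∪ D (m + j)) := by
          refine hC.trans (Set.union_subset ?_ (Set.iUnion_subset fun j => ?_))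
          · exact (ray_mono Finset.subset_union_left).trans
              (Set.subset_iUnion (fun j => ray (row m ∪ D (m + j))) 0)
          · refine (ray_mono ?_).trans (Set.subset_iUnion (fun j => ray (row m ∪ D (m + j))) j)
            exact (hDmono (Nat.le_add_left _ _)).trans Finset.subset_union_right
        refine Directed.exists_mem_subset_of_finset_subset_biUnion ?_ h1
        exact (monotone_nat_of_le_succ (f := fun j => ray (row m ∪ D (m + j)))
          fun j => ray_mono (Finset.union_subset_union_right
            (hDmono (Nat.le_succ _)))).directed_le
      have := hb j
      have h3 : (0 : ℝ) < (1 / 2) ^ (m + j) := by positivity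
      linarith [hF.condF_le (A := A) hj]
    calc n * (rowRate F m - (1 / 2) ^ m)
        = ∑ i ∈ Finset.range n, (rowRate F m - (1 / 2) ^ m) := by
          rw [Finset.sum_const, Finset.card_range, nsmul_eq_mul]
      _ ≤ ∑ i ∈ Finset.range n, condF F A (ray (row m) ∪ timeShift i '' G) := by
          refine Finset.sum_le_sum fun i _ => hone.trans (hF.condF_anti _ ?_)
          refine Set.union_subset_union_right _ fun s hs => ?_
          rw [mem_image_timeShift] at hs
          simpa using hGs _ hs i
      _ = condF F (seg (row m) n) (ray (row m) ∪ G) := (hF.condF_seg _ _ _).symm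
      _ ≤ condF F (seg (row m) n) G := hF.condF_anti _ Set.subset_union_right

end IsEntropyFn

/-- The Shannon entropy of a finite-valued map. -/
def ent [MeasurableSpace X] (μ : Measure X) {β : Type*} [Fintype β] (Y : X → β) : ℝ :=
  ∑ b, Real.negMulLog (μ.real (Y ⁻¹' {b}))

section Entropy

variable [MeasurableSpace X] {μ : Measure X} [IsProbabilityMeasure μ]
variable {α β γ : Type*} [Fintype α] [Fintype β] [Fintype γ]

lemma measureReal_eq_sum_inter {Y : X → β} (hY : ∀ b, MeasurableSet (Y ⁻¹' {b})) (S : Set X) :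
    μ.real S = ∑ b, μ.real (Y ⁻¹' {b} ∩ S) := by
  classical
  have h := measureReal_biUnion_finset (μ := μ.restrict S) (s := (Finset.univ : Finset β))
    (f := fun b => Y ⁻¹' {b})
    (fun a _ b _ hab => Disjoint.preimage _ (by simpa using hab)) (fun b _ => hY b)
  have h2 : (⋃ b ∈ (Finset.univ : Finset β), Y ⁻¹' {b}) = univ := by ext; simp
  rw [h2, measureReal_restrict_apply_univ] at h
  rw [h]
  exact Finset.sum_congr rfl fun b _ => measureReal_restrict_apply (hY b)

/-- Gibbs' inequality for one term. -/
lemma negMulLog_le_cross {p q : ℝ} (hp : 0 ≤ p) (hq : 0 ≤ q) (h : q = 0 → p = 0) :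
    Real.negMulLog p ≤ -(p * Real.log q) + (q - p) := by
  rcases hp.eq_or_lt with rfl | hp
  · simpa using hq
  have hq' : 0 < q := hq.lt_of_ne fun h0 => hp.ne' (h h0.symm)
  have h1 := Real.log_le_sub_one_of_pos (div_pos hq' hp)
  rw [Real.log_div hq'.ne' hp.ne'] at h1
  have h2 := mul_le_mul_of_nonneg_left h1 hp.le
  have h3 : p * (q / p - 1) = q - p := by field_simp
  rw [Real.negMulLog]
  linarith

/-- Entropy does not increase under coarsening. -/
lemma ent_le_of_determined {Y : X → β} {Z : X → γ} (hY : ∀ b, MeasurableSet (Y ⁻¹' {b}))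
    (h : ∀ x y, Y x = Y y → Z x = Z y) : ent μ Z ≤ ent μ Y := by
  classical
  by_cases hX : Nonempty X
  swap
  · rw [not_nonempty_iff] at hX
    simp [ent, Set.eq_empty_of_isEmpty]
  have : Nonempty γ := hX.map Z
  obtain ⟨φ, hφ⟩ : ∃ φ : β → γ, ∀ x, Z x = φ (Y x) :=
    ⟨Function.extend Y Z fun _ => Classical.arbitrary γ, fun x =>
      (Function.FactorsThrough.extend_apply (fun a b hab => h a b hab) _ x).symm⟩
  have hp : ∀ c, μ.real (Z ⁻¹' {c}) =
      ∑ b ∈ Finset.univ.filter (φ · = c), μ.real (Y ⁻¹' {b}) := by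
    intro c
    rw [measureReal_eq_sum_inter hY (Z ⁻¹' {c}), Finset.sum_filter]
    refine Finset.sum_congr rfl fun b _ => ?_
    split_ifs with hb
    · congr 1
      refine Set.inter_eq_left.2 fun x hx => ?_
      simp only [mem_preimage, mem_singleton_iff] at hx ⊢
      rw [hφ, hx, hb]
    · rw [show Y ⁻¹' {b} ∩ Z ⁻¹' {c} = ∅ from ?_, measureReal_empty]
      refine Set.eq_empty_of_forall_notMem fun x hx => hb ?_
      have h1 : Y x = b := hx.1
      rw [← h1, ← hφ]; exact hx.2
  rw [ent, ent, ← Finset.sum_fiberwise_of_maps_to (s := Finset.univ) (t := Finset.univ) (g := φ)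
    (fun b _ => Finset.mem_univ _)]
  refine Finset.sum_le_sum fun c _ => ?_
  rw [Real.negMulLog, neg_mul]
  nth_rw 1 [hp c]
  rw [Finset.sum_mul, ← Finset.sum_neg_distrib]
  refine Finset.sum_le_sum fun b hb => ?_
  rw [Real.negMulLog, neg_mul, neg_le_neg_iff]
  rcases (measureReal_nonneg (μ := μ) (s := Y ⁻¹' {b})).eq_or_lt with h0 | h0
  · simp [← h0]
  refine mul_le_mul_of_nonneg_left (Real.log_le_log h0 ?_) h0.le
  rw [hp]
  exact Finset.single_le_sum (f := fun b => μ.real (Y ⁻¹' {b}))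
    (fun _ _ => measureReal_nonneg) hb

omit [Fintype α] [Fintype β] in
lemma measurableSet_pair {Y : X → α} {Z : X → β} (hY : ∀ b, MeasurableSet (Y ⁻¹' {b}))
    (hZ : ∀ b, MeasurableSet (Z ⁻¹' {b})) (p : α × β) :
    MeasurableSet ((fun x => (Y x, Z x)) ⁻¹' {p}) := by
  convert (hY p.1).inter (hZ p.2) using 1
  ext x; simp [Prod.ext_iff]

/-- Submodularity of Shannon entropy. -/
lemma ent_submod {Y : X → α} {Z : X → β} {W : X → γ} (hY : ∀ b, MeasurableSet (Y ⁻¹' {b}))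
    (hZ : ∀ b, MeasurableSet (Z ⁻¹' {b})) :
    ent μ (fun x => (Y x, Z x, W x)) + ent μ W ≤
      ent μ (fun x => (Y x, W x)) + ent μ (fun x => (Z x, W x)) := by
  set p : α → β → γ → ℝ := fun a b c => μ.real ((fun x => (Y x, Z x, W x)) ⁻¹' {(a, b, c)})
    with hp
  set pY : α → γ → ℝ := fun a c => μ.real ((fun x => (Y x, W x)) ⁻¹' {(a, c)}) with hpY
  set pZ : β → γ → ℝ := fun b c => μ.real ((fun x => (Z x, W x)) ⁻¹' {(b, c)}) with hpZ
  set pW : γ → ℝ := fun c => μ.real (W ⁻¹' {c}) with hpW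
  have eY : ∀ a c, pY a c = ∑ b, p a b c := by
    intro a c
    rw [hpY]; simp only
    rw [measureReal_eq_sum_inter hZ]
    refine Finset.sum_congr rfl fun b _ => ?_
    rw [hp]; simp only; congr 1; ext x; simp; tauto
  have eZ : ∀ b c, pZ b c = ∑ a, p a b c := by
    intro b c
    rw [hpZ]; simp only
    rw [measureReal_eq_sum_inter hY]
    refine Finset.sum_congr rfl fun a _ => ?_
    rw [hp]; simp only; congr 1; ext x; simp
  have eWY : ∀ c, pW c = ∑ a, pY a c := by
    intro c
    rw [hpW]; simp only
    rw [measureReal_eq_sum_inter hY]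
    refine Finset.sum_congr rfl fun a _ => ?_
    rw [hpY]; simp only; congr 1; ext x; simp
  have eWZ : ∀ c, pW c = ∑ b, pZ b c := by
    intro c
    rw [hpW]; simp only
    rw [measureReal_eq_sum_inter hZ]
    refine Finset.sum_congr rfl fun a _ => ?_
    rw [hpZ]; simp only; congr 1; ext x; simp
  have p0 : ∀ a b c, 0 ≤ p a b c := fun _ _ _ => measureReal_nonneg
  have pY0 : ∀ a c, 0 ≤ pY a c := fun _ _ => measureReal_nonneg
  have pZ0 : ∀ b c, 0 ≤ pZ b c := fun _ _ => measureReal_nonneg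
  have pW0 : ∀ c, 0 ≤ pW c := fun _ => measureReal_nonneg
  have lY : ∀ a b c, p a b c ≤ pY a c := fun a b c => by
    rw [eY]; exact Finset.single_le_sum (f := fun b => p a b c) (fun b _ => p0 a b c)
      (Finset.mem_univ b)
  have lZ : ∀ a b c, p a b c ≤ pZ b c := fun a b c => by
    rw [eZ]; exact Finset.single_le_sum (f := fun a => p a b c) (fun a _ => p0 a b c)
      (Finset.mem_univ a)
  have lW : ∀ a c, pY a c ≤ pW c := fun a c => by
    rw [eWY]; exact Finset.single_le_sum (f := fun a => pY a c) (fun a _ => pY0 a c)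
      (Finset.mem_univ a)
  have h1 : ∀ a b c, Real.negMulLog (p a b c) ≤ -(p a b c * Real.log (pY a c))
      - p a b c * Real.log (pZ b c) + p a b c * Real.log (pW c)
      + (pY a c * pZ b c / pW c - p a b c) := by
    intro a b c
    rcases (p0 a b c).eq_or_lt with h0 | h0
    · rw [← h0]
      have := div_nonneg (mul_nonneg (pY0 a c) (pZ0 b c)) (pW0 c)
      simpa using this
    have hY' := h0.trans_le (lY a b c)
    have hZ' := h0.trans_le (lZ a b c)
    have hW' := hY'.trans_le (lW a c)
    have hq : 0 < pY a c * pZ b c / pW c := by positivity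
    have := negMulLog_le_cross h0.le hq.le (fun h => absurd h hq.ne')
    rw [Real.log_div (by positivity) hW'.ne', Real.log_mul hY'.ne' hZ'.ne'] at this
    linarith
  have hq : ∑ a, ∑ b, ∑ c, pY a c * pZ b c / pW c ≤ ∑ a, ∑ b, ∑ c, p a b c := by
    have e1 : ∑ a, ∑ b, ∑ c, pY a c * pZ b c / pW c = ∑ c, pW c * pW c / pW c := by
      rw [Finset.sum_congr rfl fun a _ => Finset.sum_comm, Finset.sum_comm]
      refine Finset.sum_congr rfl fun c _ => ?_
      nth_rw 2 [eWY]
      rw [eWZ c, Finset.sum_mul, Finset.sum_div]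
      refine Finset.sum_congr rfl fun a _ => ?_
      rw [Finset.mul_sum, Finset.sum_div]
    have e2 : ∑ a, ∑ b, ∑ c, p a b c = ∑ c, pW c := by
      rw [Finset.sum_congr rfl fun a _ => Finset.sum_comm, Finset.sum_comm]
      refine Finset.sum_congr rfl fun c _ => ?_
      rw [eWY]
      exact Finset.sum_congr rfl fun a _ => (eY a c).symm
    rw [e1, e2]
    refine Finset.sum_le_sum fun c _ => ?_
    rw [mul_self_div_self]
  have i1 : ent μ (fun x => (Y x, Z x, W x)) = ∑ a, ∑ b, ∑ c, Real.negMulLog (p a b c) := by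
    rw [ent, Fintype.sum_prod_type]
    exact Finset.sum_congr rfl fun a _ => Fintype.sum_prod_type _
  have i2 : ent μ (fun x => (Y x, W x)) = ∑ a, ∑ b, ∑ c, -(p a b c * Real.log (pY a c)) := by
    rw [ent, Fintype.sum_prod_type]
    refine Finset.sum_congr rfl fun a _ => ?_
    rw [Finset.sum_comm]
    refine Finset.sum_congr rfl fun c _ => ?_
    rw [Finset.sum_neg_distrib, ← Finset.sum_mul, ← eY, Real.negMulLog, neg_mul]
  have i3 : ent μ (fun x => (Z x, W x)) = ∑ a, ∑ b, ∑ c, p a b c * -Real.log (pZ b c) := by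
    rw [Finset.sum_comm (s := (Finset.univ : Finset α)), ent, Fintype.sum_prod_type]
    refine Finset.sum_congr rfl fun b _ => ?_
    rw [Finset.sum_comm (s := (Finset.univ : Finset α))]
    refine Finset.sum_congr rfl fun c _ => ?_
    rw [← Finset.sum_mul, ← eZ, Real.negMulLog, neg_mul, mul_neg]
  have i4 : ent μ W = ∑ a, ∑ b, ∑ c, -(p a b c * Real.log (pW c)) := by
    have swap : ∀ g : α → β → γ → ℝ, ∑ a, ∑ b, ∑ c, g a b c = ∑ c, ∑ a, ∑ b, g a b c := by
      intro g
      rw [Finset.sum_comm (s := (Finset.univ : Finset γ))]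
      exact Finset.sum_congr rfl fun a _ => Finset.sum_comm
    rw [ent, swap]
    refine Finset.sum_congr rfl fun c _ => ?_
    have : pW c = ∑ a, ∑ b, p a b c := by
      rw [eWY]; exact Finset.sum_congr rfl fun a _ => eY a c
    rw [Real.negMulLog, neg_mul]
    change -(pW c * Real.log (pW c)) = _
    nth_rw 1 [this]
    simp only [Finset.sum_mul, Finset.sum_neg_distrib]
  have h2 : ∑ a, ∑ b, ∑ c, Real.negMulLog (p a b c) ≤ ∑ a, ∑ b, ∑ c,
      (-(p a b c * Real.log (pY a c)) - p a b c * Real.log (pZ b c) + p a b c * Real.log (pW c)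
      + (pY a c * pZ b c / pW c - p a b c)) :=
    Finset.sum_le_sum fun a _ => Finset.sum_le_sum fun b _ => Finset.sum_le_sum fun c _ => h1 a b c
  simp only [Finset.sum_add_distrib, Finset.sum_sub_distrib] at h2
  rw [i1, i2, i3, i4]
  simp only [mul_neg, Finset.sum_neg_distrib] at h2 ⊢
  linarith

omit [IsProbabilityMeasure μ] in
lemma ent_comp {Y : X → β} (hY : ∀ b, MeasurableSet (Y ⁻¹' {b})) {T : X → X}
    (hT : MeasurePreserving T μ μ) : ent μ (Y ∘ T) = ent μ Y := by
  refine Finset.sum_congr rfl fun b _ => ?_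
  rw [Set.preimage_comp, hT.measureReal_preimage (hY b).nullMeasurableSet]

end Entropy

section CondEntropy

variable [mX : MeasurableSpace X] {μ : Measure X} [IsProbabilityMeasure μ]
variable {β γ : Type*} [Fintype β] [Fintype γ] [MeasurableSpace γ] [MeasurableSingletonClass γ]

omit [IsProbabilityMeasure μ] in
lemma integral_comp_finite [IsFiniteMeasure μ] {Z : X → γ} (hZ : Measurable Z) (φ : γ → ℝ) :
    ∫ x, φ (Z x) ∂μ = ∑ c, μ.real (Z ⁻¹' {c}) * φ c := by
  rw [← integral_map (f := φ) hZ.aemeasurable (measurable_of_finite φ).aestronglyMeasurable]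
  have : IsFiniteMeasure (μ.map Z) := Measure.isFiniteMeasure_map _ _
  rw [integral_fintype .of_finite]
  refine Finset.sum_congr rfl fun c _ => ?_
  rw [map_measureReal_apply hZ (measurableSet_singleton c), smul_eq_mul]

lemma condExp_comap_finite {Z : X → γ} (hZ : Measurable Z) {C : Set X} (hC : MeasurableSet C) :
    μ[C.indicator (fun _ => (1 : ℝ)) | MeasurableSpace.comap Z inferInstance] =ᵐ[μ]
      fun x => μ.real (Z ⁻¹' {Z x} ∩ C) / μ.real (Z ⁻¹' {Z x}) := by
  classical
  set φ : γ → ℝ := fun c => μ.real (Z ⁻¹' {c} ∩ C) / μ.real (Z ⁻¹' {c}) with hφ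
  have hφm : Measurable φ := measurable_of_finite φ
  have hφ1 : ∀ c, ‖φ c‖ ≤ 1 := by
    intro c
    rw [Real.norm_of_nonneg (by positivity)]
    exact div_le_one_of_le₀ (measureReal_mono Set.inter_subset_left) measureReal_nonneg
  have hgi : Integrable (fun x => φ (Z x)) μ :=
    Integrable.of_bound (hφm.comp hZ).aestronglyMeasurable 1 (ae_of_all _ fun x => hφ1 _)
  refine (ae_eq_condExp_of_forall_setIntegral_eq hZ.comap_le
    ((integrable_const (1 : ℝ)).indicator hC) (fun _ _ _ => hgi.integrableOn) ?_
    (hφm.comp (comap_measurable Z)).aestronglyMeasurable).symm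
  rintro s ⟨B, hB, rfl⟩ -
  rw [integral_comp_finite hZ φ, setIntegral_indicator hC, setIntegral_const, smul_eq_mul, mul_one,
    measureReal_eq_sum_inter (fun c => hZ (measurableSet_singleton c)) (Z ⁻¹' B ∩ C)]
  refine Finset.sum_congr rfl fun c _ => ?_
  rw [measureReal_restrict_apply (hZ (measurableSet_singleton c))]
  by_cases hc : c ∈ B
  · have e : Z ⁻¹' {c} ∩ Z ⁻¹' B = Z ⁻¹' {c} :=
      Set.inter_eq_left.2 (Set.preimage_mono (by simpa using hc))
    rw [← Set.inter_assoc, e, hφ]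
    by_cases h0 : μ.real (Z ⁻¹' {c}) = 0
    · rw [h0, zero_mul]
      exact (le_antisymm ((measureReal_mono Set.inter_subset_left).trans h0.le)
        measureReal_nonneg).symm
    · simp only; field_simp
  · have e : Z ⁻¹' {c} ∩ Z ⁻¹' B = ∅ := by
      rw [← Set.preimage_inter]
      rw [show ({c} ∩ B : Set γ) = ∅ by simpa using hc, Set.preimage_empty]
    rw [← Set.inter_assoc, e]
    simp

lemma mul_negMulLog_div {p q : ℝ} (h : p = 0 → q = 0) :
    p * Real.negMulLog (q / p) = Real.negMulLog q + q * Real.log p := by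
  by_cases hp : p = 0
  · simp [hp, h hp]
  by_cases hq : q = 0
  · simp [hq]
  rw [Real.negMulLog, Real.negMulLog, Real.log_div hq hp]
  field_simp
  ring

lemma sum_integral_condExp_comap {Y : X → β} (hY : ∀ b, MeasurableSet (Y ⁻¹' {b})) {Z : X → γ}
    (hZ : Measurable Z) :
    ∑ b, ∫ x, Real.negMulLog ((μ[(Y ⁻¹' {b}).indicator (fun _ => (1 : ℝ)) |
      MeasurableSpace.comap Z inferInstance]) x) ∂μ = ent μ (fun x => (Y x, Z x)) - ent μ Z := by
  have h1 : ∀ b, ∫ x, Real.negMulLog ((μ[(Y ⁻¹' {b}).indicator (fun _ => (1 : ℝ)) |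
      MeasurableSpace.comap Z inferInstance]) x) ∂μ =
      ∑ c, (Real.negMulLog (μ.real (Z ⁻¹' {c} ∩ Y ⁻¹' {b})) +
        μ.real (Z ⁻¹' {c} ∩ Y ⁻¹' {b}) * Real.log (μ.real (Z ⁻¹' {c}))) := by
    intro b
    have h2 := condExp_comap_finite (μ := μ) hZ (hY b)
    refine (integral_congr_ae (h2.fun_comp Real.negMulLog)).trans ((integral_comp_finite hZ fun c =>
      Real.negMulLog (μ.real (Z ⁻¹' {c} ∩ Y ⁻¹' {b}) / μ.real (Z ⁻¹' {c}))).trans ?_)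
    refine Finset.sum_congr rfl fun c _ => mul_negMulLog_div fun h0 => ?_
    exact le_antisymm ((measureReal_mono Set.inter_subset_left).trans h0.le) measureReal_nonneg
  have h2 : ∀ b c, (fun x => (Y x, Z x)) ⁻¹' {(b, c)} = Z ⁻¹' {c} ∩ Y ⁻¹' {b} := by
    intro b c
    ext x
    simp [and_comm]
  have h3 : ∑ b, ∑ c, μ.real (Z ⁻¹' {c} ∩ Y ⁻¹' {b}) * Real.log (μ.real (Z ⁻¹' {c})) =
      -ent μ Z := by
    rw [Finset.sum_comm, ent, ← Finset.sum_neg_distrib]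
    refine Finset.sum_congr rfl fun c _ => ?_
    rw [← Finset.sum_mul, Real.negMulLog, neg_mul, neg_neg,
      measureReal_eq_sum_inter hY (Z ⁻¹' {c})]
    simp only [Set.inter_comm]
  simp only [h1, Finset.sum_add_distrib]
  rw [h3, sub_eq_add_neg, ent.eq_1 μ fun x => (Y x, Z x), Fintype.sum_prod_type]
  simp only [h2]

/-- The filtration generated by a sequence of bits. -/
def bitFiltration (V : ℕ → X → Bool) (hV : ∀ i, Measurable (V i)) :
    Filtration ℕ (inferInstance : MeasurableSpace X) where
  seq l := MeasurableSpace.comap (fun x (i : Fin l) => V i x) inferInstance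
  mono' := by
    intro k l hkl
    have h : (fun x (i : Fin k) => V i x) =
      (fun (v : Fin l → Bool) (i : Fin k) => v (Fin.castLE hkl i)) ∘
        (fun x (i : Fin l) => V i x) := rfl
    simp only
    rw [h, ← MeasurableSpace.comap_comp]
    exact MeasurableSpace.comap_mono (measurable_of_finite _).comap_le
  le' l := (measurable_pi_lambda _ fun i : Fin l => hV i).comap_le

/-- The `σ`-algebra generated by a sequence of bits. -/
@[reducible] def bitSigma (V : ℕ → X → Bool) (hV : ∀ i, Measurable (V i)) : MeasurableSpace X :=
  ⨆ l, bitFiltration V hV l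

lemma bitSigma_le (V : ℕ → X → Bool) (hV : ∀ i, Measurable (V i)) : bitSigma V hV ≤ mX :=
  iSup_le fun l => (bitFiltration V hV).le l

open ProbabilityTheory in
/-- The mean entropy of the conditional measures given a sequence of bits is at least every lower
bound for the conditional entropies given finitely many of the bits. -/
theorem le_integral_ent_condExpKernel [StandardBorelSpace X] (V : ℕ → X → Bool)
    (hV : ∀ i, Measurable (V i)) {Y : X → β} (hY : ∀ b, MeasurableSet (Y ⁻¹' {b})) {b : ℝ}
    (h : ∀ l, b ≤ ent μ (fun x => (Y x, fun i : Fin l => V i x)) -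
      ent μ (fun x (i : Fin l) => V i x)) :
    b ≤ ∫ x, ent (condExpKernel μ (bitSigma V hV) x) Y ∂μ := by
  have hmle := bitSigma_le V hV
  have hbound : ∀ (s : MeasurableSpace X) (c : β), ∀ᵐ x ∂μ,
      (μ[(Y ⁻¹' {c}).indicator (fun _ => (1 : ℝ)) | s]) x ∈ Icc (0 : ℝ) 1 := by
    intro s c
    have hi : Integrable ((Y ⁻¹' {c}).indicator (fun _ => (1 : ℝ))) μ :=
      (integrable_const (1 : ℝ)).indicator (hY c)
    by_cases hs : s ≤ mX
    swap
    · rw [condExp_of_not_le hs]; exact ae_of_all _ fun _ => by simp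
    have h0 : 0 ≤ᵐ[μ] μ[(Y ⁻¹' {c}).indicator (fun _ => (1 : ℝ)) | s] :=
      condExp_nonneg (ae_of_all _ fun x => Set.indicator_nonneg (fun _ _ => zero_le_one) x)
    have h1 : μ[(Y ⁻¹' {c}).indicator (fun _ => (1 : ℝ)) | s] ≤ᵐ[μ] μ[fun _ => (1 : ℝ) | s] :=
      condExp_mono hi (integrable_const _)
        (ae_of_all _ fun x => Set.indicator_le_self' (fun _ _ => zero_le_one) x)
    rw [condExp_const hs] at h1
    filter_upwards [h0, h1] with x h0 h1 using ⟨h0, h1⟩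
  have hlim : Tendsto (fun l => ∑ c, ∫ x, Real.negMulLog
      ((μ[(Y ⁻¹' {c}).indicator (fun _ => (1 : ℝ)) | bitFiltration V hV l]) x) ∂μ) atTop
      (𝓝 (∑ c, ∫ x, Real.negMulLog
      ((μ[(Y ⁻¹' {c}).indicator (fun _ => (1 : ℝ)) | bitSigma V hV]) x) ∂μ)) := by
    refine tendsto_finsetSum _ fun c _ => ?_
    obtain ⟨K, hK⟩ := isCompact_Icc.exists_bound_of_continuousOn (s := Icc (0 : ℝ) 1)
      Real.continuous_negMulLog.continuousOn
    refine tendsto_integral_of_dominated_convergence (fun _ => K) (fun l => ?_)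
      (integrable_const _) (fun l => ?_) ?_
    · exact Real.continuous_negMulLog.comp_aestronglyMeasurable
        (stronglyMeasurable_condExp.mono ((bitFiltration V hV).le l)).aestronglyMeasurable
    · filter_upwards [hbound (bitFiltration V hV l) c] with x hx using hK _ hx
    · filter_upwards [tendsto_ae_condExp (μ := μ) (ℱ := bitFiltration V hV)
        ((Y ⁻¹' {c}).indicator (fun _ => (1 : ℝ)))] with x hx
      exact (Real.continuous_negMulLog.tendsto _).comp hx
  refine (ge_of_tendsto' hlim fun l => ?_).trans (le_of_eq ?_)
  · have := sum_integral_condExp_comap (μ := μ) hY (Z := fun x (i : Fin l) => V i x)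
      (measurable_pi_lambda _ fun i => hV i)
    exact (h l).trans this.ge
  · have he : ∀ c, (fun x =>
        Real.negMulLog ((condExpKernel μ (bitSigma V hV) x).real (Y ⁻¹' {c}))) =ᵐ[μ] fun x =>
        Real.negMulLog
          ((μ[(Y ⁻¹' {c}).indicator (fun _ => (1 : ℝ)) | bitSigma V hV]) x) := fun c =>
      (condExpKernel_ae_eq_condExp hmle (hY c)).fun_comp Real.negMulLog
    simp only [ent]
    rw [integral_finsetSum]
    · exact Finset.sum_congr rfl fun c _ => (integral_congr_ae (he c)).symm
    · intro c _
      refine Integrable.congr ?_ (he c).symm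
      obtain ⟨K, hK⟩ := isCompact_Icc.exists_bound_of_continuousOn (s := Icc (0 : ℝ) 1)
        Real.continuous_negMulLog.continuousOn
      refine Integrable.of_bound (Real.continuous_negMulLog.comp_aestronglyMeasurable
        (stronglyMeasurable_condExp.mono hmle).aestronglyMeasurable) K ?_
      filter_upwards [hbound (bitSigma V hV) c] with x hx using hK _ hx

open ProbabilityTheory in
lemma condExpKernel_same_bits [StandardBorelSpace X] (V : ℕ → X → Bool)
    (hV : ∀ i, Measurable (V i)) :
    ∀ᵐ x ∂μ, ∀ᵐ y ∂(condExpKernel μ (bitSigma V hV) x), ∀ i, V i y = V i x := by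
  have hmle := bitSigma_le V hV
  have hVm : ∀ i, Measurable[bitSigma V hV] (V i) := by
    intro i
    have h1 : Measurable[bitFiltration V hV (i + 1)] (V i) :=
      (measurable_pi_apply (⟨i, Nat.lt_succ_self i⟩ : Fin (i + 1))).comp
        (comap_measurable (fun x (j : Fin (i + 1)) => V j x))
    exact h1.mono (le_iSup (fun l => bitFiltration V hV l) (i + 1)) le_rfl
  have h1 : ∀ (i : ℕ) (a : Bool), ∀ᵐ x ∂μ, (condExpKernel μ (bitSigma V hV) x).real (V i ⁻¹' {a}) =
      (V i ⁻¹' {a}).indicator (fun _ => (1 : ℝ)) x := by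
    intro i a
    have h2 := condExpKernel_ae_eq_condExp (μ := μ) hmle (hV i (measurableSet_singleton a))
    have hs : MeasurableSet[bitSigma V hV] (V i ⁻¹' {a}) := hVm i (measurableSet_singleton a)
    rwa [condExp_of_stronglyMeasurable hmle
      (stronglyMeasurable_const.indicator hs)
      ((integrable_const (1 : ℝ)).indicator (hV i (measurableSet_singleton a)))] at h2
  have h2 := ae_all_iff.2 fun i => ae_all_iff.2 fun a => h1 i a
  filter_upwards [h2] with x hx
  refine ae_all_iff.2 fun i => ?_
  have h3 := hx i (V i x)
  rw [Set.indicator_of_mem (by simp), measureReal_def, ENNReal.toReal_eq_one_iff] at h3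
  exact (mem_ae_iff_prob_eq_one (hV i (measurableSet_singleton _))).2 h3

end CondEntropy

section Separated

/-- A set is `(n,δ)`-separated for `S`. -/
def IsSep [MetricSpace X] (S : X → X) (n : ℕ) (δ : ℝ) (E : Finset X) : Prop :=
  ∀ x ∈ E, ∀ y ∈ E, x ≠ y → ∃ i < n, δ < dist (S^[i] x) (S^[i] y)

variable [MetricSpace X] [CompactSpace X] {S : X → X} {n : ℕ} {δ : ℝ}

lemma exists_card_le_of_isSep (hS : Continuous S) (n : ℕ) (hδ : 0 < δ) :
    ∃ N : ℕ, ∀ E : Finset X, IsSep S n δ E → E.card ≤ N := by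
  classical
  set W : X → Set X := fun e => {y | ∀ i ∈ Finset.range n, dist (S^[i] e) (S^[i] y) < δ / 2}
    with hW
  have hWo : ∀ e, IsOpen (W e) := by
    intro e
    have : W e = ⋂ i ∈ Finset.range n, {y | dist (S^[i] e) (S^[i] y) < δ / 2} := by
      ext y; simp [hW]
    rw [this]
    refine isOpen_biInter_finset fun i _ => ?_
    exact isOpen_lt (continuous_const.dist (hS.iterate i)) continuous_const
  obtain ⟨t, ht⟩ := isCompact_univ.elim_finite_subcover W hWo fun y _ =>
    mem_iUnion.2 ⟨y, fun i _ => by simpa using half_pos hδ⟩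
  refine ⟨t.card, fun E hE => ?_⟩
  have h : ∀ y, ∃ e ∈ t, y ∈ W e := fun y => by simpa using ht (mem_univ y)
  choose c hc hcW using h
  refine Finset.card_le_card_of_injOn c (fun y _ => hc y) fun x hx y hy hxy => ?_
  by_contra hne
  obtain ⟨i, hi, hlt⟩ := hE x hx y hy hne
  have h1 := hcW x i (Finset.mem_range.2 hi)
  have h2 := hcW y i (Finset.mem_range.2 hi)
  rw [← hxy] at h2
  have := dist_triangle_left (S^[i] x) (S^[i] y) (S^[i] (c x))
  linarith

/-- A maximal separated subset of `A` spans `A`. -/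
lemma exists_isSep_spanning (hS : Continuous S) (n : ℕ) (hδ : 0 < δ) (A : Set X) :
    ∃ E : Finset X, ↑E ⊆ A ∧ IsSep S n δ E ∧
      ∀ y ∈ A, ∃ e ∈ E, ∀ i < n, dist (S^[i] e) (S^[i] y) ≤ δ := by
  classical
  obtain ⟨N, hN⟩ := exists_card_le_of_isSep hS n hδ
  set P : ℕ → Prop := fun k => ∃ E : Finset X, ↑E ⊆ A ∧ IsSep S n δ E ∧ E.card = k with hP
  have hP0 : P 0 := ⟨∅, by simp, by simp [IsSep], rfl⟩
  obtain ⟨E, hEA, hE, hcard⟩ : P (Nat.findGreatest P N) := Nat.findGreatest_spec (Nat.zero_le N) hP0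
  refine ⟨E, hEA, hE, fun y hy => ?_⟩
  by_contra! h
  have hyE : y ∉ E := fun hyE => by
    obtain ⟨i, -, hi⟩ := h y hyE
    rw [dist_self] at hi
    exact hi.not_ge hδ.le
  have hsep : IsSep S n δ (insert y E) := by
    intro a ha b hb hab
    rcases Finset.mem_insert.1 ha with ha' | ha' <;> rcases Finset.mem_insert.1 hb with hb' | hb'
    · exact absurd (ha'.trans hb'.symm) hab
    · obtain ⟨i, hi, hi'⟩ := h b hb'
      exact ⟨i, hi, by rwa [ha', dist_comm]⟩
    · rw [hb']
      exact h a ha'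
    · exact hE a ha' b hb' hab
  have hP1 : P (E.card + 1) :=
    ⟨insert y E, by simpa [Set.insert_subset_iff] using ⟨hy, hEA⟩, hsep,
      Finset.card_insert_of_notMem hyE⟩
  have hle : E.card + 1 ≤ N := by
    have := hN _ hsep
    rwa [Finset.card_insert_of_notMem hyE] at this
  have := Nat.le_findGreatest hle hP1
  omega

omit [MetricSpace X] [CompactSpace X] in
lemma abs_birk_le {f : X → ℝ} {C : ℝ} (hf : ∀ x, |f x| ≤ C) (n : ℕ) (x : X) :
    |birk S f n x| ≤ n * C := by
  refine (Finset.abs_sum_le_sum_abs _ _).trans ((Finset.sum_le_sum fun i _ => hf _).trans ?_)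
  simp

lemma bddAbove_sepPn (hS : Continuous S) {f : X → ℝ} {C : ℝ} (hf : ∀ x, |f x| ≤ C) (n : ℕ)
    (hδ : 0 < δ) (A : Set X) :
    BddAbove { r : ℝ | ∃ E : Finset X, ↑E ⊆ A ∧
      (∀ x ∈ E, ∀ y ∈ E, x ≠ y → ∃ i < n, δ < dist (S^[i] x) (S^[i] y)) ∧
      r = ∑ x ∈ E, Real.exp (birk S f n x) } := by
  obtain ⟨N, hN⟩ := exists_card_le_of_isSep hS n hδ
  refine ⟨N * Real.exp (n * C), ?_⟩
  rintro _ ⟨E, -, hE, rfl⟩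
  calc ∑ x ∈ E, Real.exp (birk S f n x) ≤ ∑ x ∈ E, Real.exp (n * C) :=
        Finset.sum_le_sum fun x _ => Real.exp_le_exp.2 ((le_abs_self _).trans (abs_birk_le hf n x))
    _ = E.card * Real.exp (n * C) := by simp
    _ ≤ N * Real.exp (n * C) := by gcongr; exact hN E hE

lemma sum_le_sepPn (hS : Continuous S) {f : X → ℝ} {C : ℝ} (hf : ∀ x, |f x| ≤ C)
    (hδ : 0 < δ) {A : Set X} {E : Finset X} (hEA : ↑E ⊆ A) (hE : IsSep S n δ E) :
    ∑ x ∈ E, Real.exp (birk S f n x) ≤ sepPn S f n δ A :=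
  le_csSup (bddAbove_sepPn hS hf n hδ A) ⟨E, hEA, hE, rfl⟩

end Separated

section Gibbs

variable [MetricSpace X] [MeasurableSpace X] {ν : Measure X}
  [IsProbabilityMeasure ν] {S : X → X} {n : ℕ} {δ η θ : ℝ} {f : X → ℝ}
variable {ι : Type*} [Fintype ι] [MeasurableSpace ι] [MeasurableSingletonClass ι]

/-- The variational estimate: entropy of `n`-words plus mean Birkhoff sums is controlled by
the exponential sums over an `(n,δ)`-spanning set. -/
lemma ent_add_integral_birk_le (hS : Measurable S) (hfi : Integrable (birk S f n) ν)
    {code : X → ι} (hcode : Measurable code) {K : ι → Set X} {U : Set X}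
    (hU : MeasurableSet U) (hKU : ∀ y, y ∉ U → y ∈ K (code y))
    (hK : ∀ j j' y z, y ∈ K j → z ∈ K j' → dist y z ≤ 2 * δ → j = j')
    (hf : ∀ y z, dist y z ≤ δ → f y ≤ f z + η) (h0 : 0 < θ) (h1 : θ < 1)
    {A : Set X} (hA : ∀ᵐ y ∂ν, y ∈ A) {E : Finset X}
    (hE : ∀ y ∈ A, ∃ e ∈ E, ∀ i < n, dist (S^[i] e) (S^[i] y) ≤ δ) :
    ent ν (fun y (i : Fin n) => code (S^[i] y)) + ∫ y, birk S f n y ∂ν ≤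
      Real.log (∑ x ∈ E, Real.exp (birk S f n x)) + n * η +
      Real.log (Fintype.card ι / θ) * ∑ i ∈ Finset.range n, ν.real (S^[i] ⁻¹' U) -
      n * Real.log (1 - θ) := by
  classical
  obtain ⟨y₀, hy₀⟩ := hA.exists
  have hι : Nonempty ι := ⟨code y₀⟩
  obtain ⟨e₀, he₀, -⟩ := hE y₀ hy₀
  set k : ℝ := (Fintype.card ι : ℝ) with hk
  have hk1 : 1 ≤ k := by rw [hk]; exact_mod_cast Fintype.card_pos
  have hk0 : 0 < k := by linarith
  have hL : 0 ≤ Real.log (k / θ) := Real.log_nonneg (by rw [le_div_iff₀ h0]; linarith)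
  have hl : Real.log (1 - θ) ≤ 0 := Real.log_nonpos (by linarith) (by linarith)
  set Q : ℝ := ∑ x ∈ E, Real.exp (birk S f n x) with hQ
  have hQ0 : 0 < Q := Finset.sum_pos (fun _ _ => Real.exp_pos _) ⟨e₀, he₀⟩
  obtain ⟨v, hv⟩ : ∃ v : X → ι, ∀ x j z, z ∈ K j → dist x z ≤ δ → v x = j := by
    have : ∀ x, ∃ j₀, ∀ j z, z ∈ K j → dist x z ≤ δ → j₀ = j := by
      intro x
      by_cases hx : ∃ j z, z ∈ K j ∧ dist x z ≤ δ
      · obtain ⟨j₀, z₀, hz₀, hd₀⟩ := hx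
        refine ⟨j₀, fun j z hz hd => hK _ _ z₀ z hz₀ hz ?_⟩
        have := dist_triangle_left z₀ z x
        linarith
      · exact ⟨hι.some, fun j z hz hd => absurd ⟨j, z, hz, hd⟩ hx⟩
    choose v hv using this
    exact ⟨v, hv⟩
  set r : ι → ι → ℝ := fun a b => if a = b then 1 - θ else θ / k with hr
  have hr0 : ∀ a b, 0 < r a b := by
    intro a b
    rw [hr]; simp only
    split_ifs
    · linarith
    · positivity
  have hr1 : ∀ b, ∑ a, r a b ≤ 1 := by
    intro b
    calc ∑ a, r a b ≤ ∑ a, ((if a = b then 1 - θ else 0) + θ / k) := by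
          refine Finset.sum_le_sum fun a _ => ?_
          rw [hr]; simp only
          split_ifs
          · have : 0 < θ / k := by positivity
            linarith
          · linarith
      _ = 1 := by
          rw [Finset.sum_add_distrib]
          simp only [Finset.sum_ite_eq', Finset.mem_univ, if_true, Finset.sum_const,
            Finset.card_univ, nsmul_eq_mul]
          rw [← hk]; field_simp; ring
  set q : (Fin n → ι) → ℝ := fun w =>
    ∑ e ∈ E, Real.exp (birk S f n e) / Q * ∏ i : Fin n, r (w i) (v (S^[i] e)) with hq
  have hqe : ∀ w, ∀ e ∈ E,
      Real.exp (birk S f n e) / Q * ∏ i : Fin n, r (w i) (v (S^[i] e)) ≤ q w := by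
    intro w e he
    refine Finset.single_le_sum
      (f := fun e => Real.exp (birk S f n e) / Q * ∏ i : Fin n, r (w i) (v (S^[i] e)))
      (fun e _ => ?_) he
    have := Finset.prod_nonneg fun (i : Fin n) (_ : i ∈ Finset.univ) =>
      (hr0 (w i) (v (S^[i] e))).le
    positivity
  have hprod : ∀ (w : Fin n → ι) e, 0 < ∏ i : Fin n, r (w i) (v (S^[i] e)) :=
    fun w e => Finset.prod_pos fun i _ => hr0 _ _
  have hq0 : ∀ w, 0 < q w := fun w =>
    (mul_pos (div_pos (Real.exp_pos _) hQ0) (hprod w e₀)).trans_le (hqe w e₀ he₀)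
  have hq1 : ∑ w, q w ≤ 1 := by
    rw [hq]; simp only
    rw [Finset.sum_comm]
    calc ∑ e ∈ E, ∑ w : Fin n → ι,
          Real.exp (birk S f n e) / Q * ∏ i : Fin n, r (w i) (v (S^[i] e))
        ≤ ∑ e ∈ E, Real.exp (birk S f n e) / Q := by
          refine Finset.sum_le_sum fun e _ => ?_
          rw [← Finset.mul_sum, ← Fintype.prod_sum (fun (i : Fin n) a => r a (v (S^[i] e)))]
          refine mul_le_of_le_one_right (by positivity) ?_
          exact Finset.prod_le_one (fun i _ => Finset.sum_nonneg fun a _ => (hr0 _ _).le)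
            fun i _ => hr1 _
      _ = 1 := by rw [← Finset.sum_div, ← hQ, div_self hQ0.ne']
  have hiter : ∀ i, Measurable (S^[i]) := fun i => hS.iterate i
  set word : X → Fin n → ι := fun y i => code (S^[i] y) with hword
  have hwm : Measurable word := measurable_pi_lambda _ fun i => hcode.comp (hiter i)
  have hpt : ∀ y ∈ A, birk S f n y ≤ Real.log (q (word y)) + (Real.log Q + n * η -
      n * Real.log (1 - θ)) +
      Real.log (k / θ) * ∑ i ∈ Finset.range n, (S^[i] ⁻¹' U).indicator (fun _ => (1 : ℝ)) y := by
    intro y hy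
    obtain ⟨e, he, hd⟩ := hE y hy
    have e1 := Real.log_le_log (mul_pos (div_pos (Real.exp_pos _) hQ0) (hprod (word y) e))
      (hqe (word y) e he)
    rw [Real.log_mul (div_pos (Real.exp_pos _) hQ0).ne' (hprod _ _).ne',
      Real.log_div (Real.exp_pos _).ne' hQ0.ne', Real.log_exp,
      Real.log_prod (fun i _ => (hr0 _ _).ne')] at e1
    have e2 : ∑ i : Fin n, (Real.log (1 - θ) -
        Real.log (k / θ) * (S^[i] ⁻¹' U).indicator (fun _ => (1 : ℝ)) y) ≤
        ∑ i : Fin n, Real.log (r (word y i) (v (S^[i] e))) := by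
      refine Finset.sum_le_sum fun i _ => ?_
      have hi0 : 0 ≤ (S^[i] ⁻¹' U).indicator (fun _ => (1 : ℝ)) y :=
        Set.indicator_nonneg (fun _ _ => zero_le_one) y
      by_cases hyU : S^[i] y ∈ U
      · rw [Set.indicator_of_mem (by exact hyU), mul_one]
        rw [hr]; simp only
        split_ifs
        · linarith
        · rw [← inv_div k θ, Real.log_inv]; linarith
      · have hv' := hv (S^[i] e) _ _ (hKU _ hyU) (hd i i.2)
        rw [hr]; simp only
        rw [hv', if_pos rfl]
        have := mul_nonneg hL hi0
        linarith
    rw [Finset.sum_sub_distrib, ← Finset.mul_sum, Fin.sum_univ_eq_sum_range (fun i =>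
      (S^[i] ⁻¹' U).indicator (fun _ => (1 : ℝ)) y)] at e2
    simp only [Finset.sum_const, Finset.card_univ, Fintype.card_fin, nsmul_eq_mul] at e2
    have e3 : birk S f n y ≤ birk S f n e + n * η := by
      calc birk S f n y ≤ ∑ i ∈ Finset.range n, (f (S^[i] e) + η) :=
            Finset.sum_le_sum fun i hi => hf _ _ (by
              rw [dist_comm]; exact hd i (Finset.mem_range.1 hi))
        _ = _ := by rw [Finset.sum_add_distrib]; simp [birk]
    linarith
  have hi1 : Integrable (fun y => Real.log (q (word y))) ν := by
    have : Measurable fun w => Real.log (q w) := measurable_of_finite _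
    obtain ⟨C, hC⟩ := (Set.finite_range fun w => ‖Real.log (q w)‖).bddAbove
    exact Integrable.of_bound (this.comp hwm).aestronglyMeasurable C
      (ae_of_all _ fun y => hC ⟨word y, rfl⟩)
  have hi2 : ∀ i ∈ Finset.range n,
      Integrable (fun y => (S^[i] ⁻¹' U).indicator (fun _ => (1 : ℝ)) y) ν :=
    fun i _ => (integrable_const (1 : ℝ)).indicator (hiter i hU)
  have hi12 : Integrable (fun y => Real.log (q (word y)) +
      (Real.log Q + n * η - n * Real.log (1 - θ))) ν := hi1.add (integrable_const _)
  have hi3 : Integrable (fun y => Real.log (k / θ) *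
      ∑ i ∈ Finset.range n, (S^[i] ⁻¹' U).indicator (fun _ => (1 : ℝ)) y) ν :=
    (integrable_finsetSum _ hi2).const_mul _
  have hgi := integral_mono_ae hfi (hi12.add hi3) (hA.mono fun y hy => hpt y hy)
  simp only [Pi.add_apply] at hgi
  rw [integral_add hi12 hi3, integral_add hi1 (integrable_const _), integral_const_mul,
    integral_finsetSum _ hi2] at hgi
  simp only [integral_const, probReal_univ, one_smul] at hgi
  have hi4 : ∀ i, ∫ y, (S^[i] ⁻¹' U).indicator (fun _ => (1 : ℝ)) y ∂ν = ν.real (S^[i] ⁻¹' U) :=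
    fun i => by rw [integral_indicator (hiter i hU)]; simp
  simp only [hi4] at hgi
  rw [integral_comp_finite hwm fun w => Real.log (q w)] at hgi
  have hent : ent ν word ≤ -∑ w, ν.real (word ⁻¹' {w}) * Real.log (q w) := by
    have hp1 : ∑ w, ν.real (word ⁻¹' {w}) = 1 := by
      have := measureReal_eq_sum_inter (μ := ν) (fun w => hwm (measurableSet_singleton w)) univ
      simpa using this.symm
    have := Finset.sum_le_sum fun w (_ : w ∈ Finset.univ) =>
      negMulLog_le_cross (measureReal_nonneg (μ := ν) (s := word ⁻¹' {w})) (hq0 w).le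
        fun h => absurd h (hq0 w).ne'
    rw [Finset.sum_add_distrib, Finset.sum_sub_distrib, Finset.sum_neg_distrib, hp1] at this
    rw [ent]
    linarith
  linarith

end Gibbs

lemma exp_le_sepPn [MetricSpace X] [CompactSpace X] [MeasurableSpace X] [BorelSpace X]
    {ν : Measure X} [IsProbabilityMeasure ν] {S : X → X} {n : ℕ} {δ η θ : ℝ} {f : C(X, ℝ)}
    {ι : Type*} [Fintype ι] [MeasurableSpace ι] [MeasurableSingletonClass ι]
    (hS : Continuous S) {code : X → ι} (hcode : Measurable code) {K : ι → Set X} {U : Set X}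
    (hU : MeasurableSet U) (hKU : ∀ y, y ∉ U → y ∈ K (code y)) (hδ : 0 < δ)
    (hK : ∀ j j' y z, y ∈ K j → z ∈ K j' → dist y z ≤ 2 * δ → j = j')
    (hf : ∀ y z, dist y z ≤ δ → f y ≤ f z + η) (h0 : 0 < θ) (h1 : θ < 1)
    {A : Set X} (hA : ∀ᵐ y ∂ν, y ∈ A) :
    Real.exp (ent ν (fun y (i : Fin n) => code (S^[i] y)) + ∫ y, birk S f n y ∂ν -
      Real.log (Fintype.card ι / θ) * ∑ i ∈ Finset.range n, ν.real (S^[i] ⁻¹' U) -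
      n * (η - Real.log (1 - θ))) ≤ sepPn S f n δ A := by
  have hbc : Continuous (birk S f n) :=
    continuous_finsetSum _ fun i _ => f.continuous.comp (hS.iterate i)
  have hC : ∀ x, |f x| ≤ ‖f‖ := fun x => f.norm_coe_le_norm x
  have hfi : Integrable (birk S f n) ν := Integrable.of_bound
    hbc.measurable.aestronglyMeasurable (n * ‖f‖) (ae_of_all _ fun x => abs_birk_le hC n x)
  obtain ⟨E, hEA, hEs, hE⟩ := exists_isSep_spanning hS n hδ A
  have hb := ent_add_integral_birk_le hS.measurable hfi hcode hU hKU hK hf h0 h1 hA hE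
  have hpos : 0 < ∑ x ∈ E, Real.exp (birk S f n x) := by
    obtain ⟨y, hy⟩ := hA.exists
    obtain ⟨e, he, -⟩ := hE y hy
    exact Finset.sum_pos (fun _ _ => Real.exp_pos _) ⟨e, he⟩
  refine le_trans ?_ (sum_le_sepPn hS hC hδ hEA hEs)
  rw [← Real.le_log_iff_exp_le hpos]
  linarith

section EntBounds

variable [MeasurableSpace X] {ν : Measure X} [IsProbabilityMeasure ν] {β : Type*} [Fintype β]

lemma ent_nonneg (Y : X → β) : 0 ≤ ent ν Y :=
  Finset.sum_nonneg fun _ _ => Real.negMulLog_nonneg measureReal_nonneg measureReal_le_one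

lemma ent_le_log_card [Nonempty β] {Y : X → β} (hY : ∀ b, MeasurableSet (Y ⁻¹' {b})) :
    ent ν Y ≤ Real.log (Fintype.card β) := by
  have hk : (0 : ℝ) < Fintype.card β := by exact_mod_cast Fintype.card_pos
  have hp1 : ∑ b, ν.real (Y ⁻¹' {b}) = 1 := by
    have := measureReal_eq_sum_inter (μ := ν) hY univ
    simpa using this.symm
  have := Finset.sum_le_sum fun b (_ : b ∈ Finset.univ) =>
    negMulLog_le_cross (measureReal_nonneg (μ := ν) (s := Y ⁻¹' {b}))
      (inv_nonneg.2 hk.le) fun h => absurd h (inv_pos.2 hk).ne'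
  rw [Finset.sum_add_distrib, Finset.sum_sub_distrib, Finset.sum_neg_distrib, ← Finset.sum_mul,
    hp1, Real.log_inv] at this
  simp only [Finset.sum_const, Finset.card_univ, nsmul_eq_mul, mul_inv_cancel₀ hk.ne'] at this
  rw [ent]
  linarith

lemma abs_ent_word_le {ι : Type*} [Fintype ι] [Nonempty ι] {n : ℕ} {Y : X → Fin n → ι}
    (hY : ∀ b, MeasurableSet (Y ⁻¹' {b})) : |ent ν Y| ≤ n * Real.log (Fintype.card ι) := by
  classical
  rw [abs_of_nonneg (ent_nonneg Y)]
  refine (ent_le_log_card hY).trans_eq ?_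
  rw [Fintype.card_fun, Fintype.card_fin, Nat.cast_pow, Real.log_pow]

end EntBounds

/-- Functions with linear growth and large means are frequently large on a set of positive
measure. -/
lemma not_ae_eventually_lt [MeasurableSpace X] {μ : Measure X} [IsProbabilityMeasure μ]
    {L : ℕ → X → ℝ} (hL : ∀ n, Measurable (L n)) {M : ℝ} (hM : ∀ n x, |L n x| ≤ n * M)
    {c c' : ℝ} (h : ∀ n : ℕ, n * c ≤ ∫ x, L n x ∂μ) (hc : c' < c) :
    ¬ ∀ᵐ x ∂μ, ∀ᶠ n : ℕ in atTop, L n x < n * c' := by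
  intro hae
  have hb : ∀ n x, |max (L n x / n - c') 0| ≤ |M| + |c'| := by
    intro n x
    have h1 : |L n x / n| ≤ |M| := by
      rcases Nat.eq_zero_or_pos n with rfl | hn
      · simp
      · have hn' : (0 : ℝ) < n := by exact_mod_cast hn
        rw [abs_div, abs_of_pos hn', div_le_iff₀ hn']
        refine (hM n x).trans ?_
        rw [mul_comm]
        exact mul_le_mul_of_nonneg_right (le_abs_self M) hn'.le
    have h2 := abs_le.1 h1
    have h3 := abs_le.1 (le_refl |c'|)
    rw [abs_of_nonneg (le_max_right _ _)]
    refine max_le (by linarith) (by positivity)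
  have hm : ∀ n, Measurable fun x => max (L n x / n - c') 0 := fun n =>
    (((hL n).div_const _).sub_const _).max measurable_const
  have hlim : Tendsto (fun n : ℕ => ∫ x, max (L n x / n - c') 0 ∂μ) atTop
      (𝓝 (∫ _, (0 : ℝ) ∂μ)) := by
    refine tendsto_integral_of_dominated_convergence (fun _ => |M| + |c'|)
      (fun n => (hm n).aestronglyMeasurable) (integrable_const _)
      (fun n => ae_of_all _ fun x => hb n x) ?_
    filter_upwards [hae] with x hx
    refine tendsto_const_nhds.congr' ?_
    filter_upwards [hx, eventually_gt_atTop 0] with n hn hn0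
    have hn' : (0 : ℝ) < n := by exact_mod_cast hn0
    rw [max_eq_right]
    have : L n x / n < c' := by rw [div_lt_iff₀ hn']; linarith
    linarith
  have hle : ∀ᶠ n : ℕ in atTop, c - c' ≤ ∫ x, max (L n x / n - c') 0 ∂μ := by
    filter_upwards [eventually_gt_atTop 0] with n hn0
    have hn' : (0 : ℝ) < n := by exact_mod_cast hn0
    have hi : Integrable (L n) μ :=
      Integrable.of_bound (hL n).aestronglyMeasurable (n * M) (ae_of_all _ fun x => hM n x)
    have hi2 : Integrable (fun x => L n x / n - c') μ := (hi.div_const _).sub (integrable_const _)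
    have h1 : ∫ x, (L n x / n - c') ∂μ ≤ ∫ x, max (L n x / n - c') 0 ∂μ :=
      integral_mono hi2 (Integrable.of_bound (hm n).aestronglyMeasurable _
        (ae_of_all _ fun x => hb n x)) fun x => le_max_left _ _
    rw [integral_sub (hi.div_const _) (integrable_const _), integral_div] at h1
    simp only [integral_const, probReal_univ, one_smul] at h1
    have h2 : c ≤ (∫ x, L n x ∂μ) / n := by rw [le_div_iff₀ hn', mul_comm]; exact h n
    linarith
  have := ge_of_tendsto hlim hle
  simp only [integral_zero] at this
  linarith

lemma sepPn_mono_image [MetricSpace X] [CompactSpace X] {S T : X → X} (hS : Continuous S)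
    (hST : ∀ x, S (T x) = x) {f : X → ℝ} {C : ℝ} (hf : ∀ x, |f x| ≤ C) {δ : ℝ} (hδ : 0 < δ)
    {A B : Set X} (N n : ℕ) (hAB : T^[N] '' A ⊆ B) :
    Real.exp (-(N * C)) * sepPn S f n δ A ≤ sepPn S f (n + N) δ B := by
  classical
  have hST' : ∀ x, S^[N] (T^[N] x) = x := fun x => (Function.LeftInverse.iterate hST N) x
  rw [mul_comm, ← le_div_iff₀ (Real.exp_pos _)]
  refine csSup_le ⟨0, ∅, by simp, by simp, by simp⟩ ?_
  rintro _ ⟨E, hEA, hE, rfl⟩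
  rw [le_div_iff₀ (Real.exp_pos _)]
  have hinj : Function.Injective (T^[N]) := (Function.LeftInverse.injective hST' :)
  have hsub : ((E.image (T^[N]) : Finset X) : Set X) ⊆ B := by
    rw [Finset.coe_image]
    exact (Set.image_mono hEA).trans hAB
  have hsep : IsSep S (n + N) δ (E.image (T^[N])) := by
    intro x hx y hy hxy
    obtain ⟨a, ha, rfl⟩ := Finset.mem_image.1 hx
    obtain ⟨b, hb, rfl⟩ := Finset.mem_image.1 hy
    obtain ⟨i, hi, h⟩ := hE a ha b hb fun h => hxy (by rw [h])
    refine ⟨i + N, by omega, ?_⟩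
    rwa [Function.iterate_add_apply, Function.iterate_add_apply, hST', hST']
  refine le_trans ?_ (sum_le_sepPn hS hf hδ hsub hsep)
  rw [Finset.sum_image fun a _ b _ h => hinj h, Finset.sum_mul]
  refine Finset.sum_le_sum fun e _ => ?_
  rw [← Real.exp_add]
  refine Real.exp_le_exp.2 ?_
  have h1 : birk S f (n + N) (T^[N] e) = birk S f N (T^[N] e) + birk S f n e := by
    rw [birk, add_comm n N, Finset.sum_range_add]
    congr 1
    refine Finset.sum_congr rfl fun i _ => ?_
    rw [add_comm N i, Function.iterate_add_apply, hST']
  have h2 := (abs_le.1 (abs_birk_le (S := S) hf N (T^[N] e))).1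
  linarith

lemma le_pres_of_frequently [MetricSpace X] {S : X → X} {f : X → ℝ} {A : Set X} {δ : ℝ}
    (hδ : 0 < δ) {c : ℝ} (h : ∃ᶠ n : ℕ in atTop, Real.exp (n * c) ≤ sepPn S f n δ A) :
    (c : EReal) ≤ pres S f A := by
  refine le_trans ?_ (le_iSup₂_of_le δ hδ le_rfl)
  refine le_limsup_of_frequently_le' ?_
  refine (h.and_eventually (eventually_gt_atTop 0)).mono ?_
  rintro n ⟨hn, hn0⟩
  have hn' : (0 : ℝ) < n := by exact_mod_cast hn0
  rw [EReal.coe_le_coe_iff, le_div_iff₀ hn', mul_comm,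
    Real.le_log_iff_exp_le ((Real.exp_pos _).trans_le hn)]
  exact hn

/-- Compact approximation of a finite measurable partition, together with a scale at which the
approximating sets are separated and a given continuous function is almost constant. -/
lemma exists_compact_approx [MetricSpace X] [CompactSpace X] [MeasurableSpace X] [BorelSpace X]
    {ι : Type*} [Fintype ι] [MeasurableSpace ι] [MeasurableSingletonClass ι]
    (μ : Measure X) [IsProbabilityMeasure μ] (f : C(X, ℝ)) {code : X → ι} (hcode : Measurable code)
    {ε η : ℝ} (hε : 0 < ε) (hη : 0 < η) :
    ∃ (K : ι → Set X) (U : Set X) (δ : ℝ), MeasurableSet U ∧ (∀ y, y ∉ U → y ∈ K (code y)) ∧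
      μ.real U ≤ ε ∧ 0 < δ ∧ (∀ j j' y z, y ∈ K j → z ∈ K j' → dist y z ≤ 2 * δ → j = j') ∧
      ∀ y z, dist y z ≤ δ → f y ≤ f z + η := by
  classical
  have hm : ∀ j, MeasurableSet (code ⁻¹' {j}) := fun j => hcode (measurableSet_singleton j)
  have hex : ∀ j, ∃ K ⊆ code ⁻¹' {j}, IsCompact K ∧
      μ (code ⁻¹' {j} \ K) < ENNReal.ofReal (ε / (Fintype.card ι + 1)) := fun j =>
    (hm j).exists_isCompact_sdiff_lt (measure_ne_top _ _) (by
      rw [Ne, ENNReal.ofReal_eq_zero, not_le]; positivity)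
  choose K hKs hKc hKm using hex
  have hU : MeasurableSet (⋃ j, code ⁻¹' {j} \ K j) :=
    MeasurableSet.iUnion fun j => (hm j).diff (hKc j).measurableSet
  have hμU : μ.real (⋃ j, code ⁻¹' {j} \ K j) ≤ ε := by
    refine (measureReal_iUnion_fintype_le _).trans ?_
    calc ∑ j, μ.real (code ⁻¹' {j} \ K j) ≤ ∑ j : ι, ε / (Fintype.card ι + 1) :=
          Finset.sum_le_sum fun j _ => by
            rw [measureReal_def]
            exact ENNReal.toReal_le_of_le_ofReal (by positivity) (hKm j).le
      _ ≤ ε := by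
          rw [Finset.sum_const, Finset.card_univ, nsmul_eq_mul, mul_div_assoc',
            div_le_iff₀ (by positivity)]
          nlinarith
  have h1 : ∀ j j', ∀ᶠ δ : ℝ in 𝓝[>] 0,
      ∀ y z, y ∈ K j → z ∈ K j' → dist y z ≤ 2 * δ → j = j' := by
    intro j j'
    by_cases hj : j = j'
    · exact Eventually.of_forall fun _ _ _ _ _ _ => hj
    have hd : Disjoint (K j) (K j') :=
      Disjoint.mono (hKs j) (hKs j') (Disjoint.preimage _ (by simpa using hj))
    obtain ⟨r, hr0, hr⟩ := Metric.exists_pos_forall_lt_edist (hKc j) (hKc j').isClosed hd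
    have hr0' : (0 : ℝ) < r / 2 := by positivity
    filter_upwards [Ioo_mem_nhdsGT hr0'] with δ hδ y z hy hz hyz
    have := hr y hy z hz
    rw [edist_nndist, ENNReal.coe_lt_coe, ← NNReal.coe_lt_coe, coe_nndist] at this
    linarith [hδ.2]
  have h2 : ∀ᶠ δ : ℝ in 𝓝[>] 0, ∀ y z, dist y z ≤ δ → f y ≤ f z + η := by
    have huc : UniformContinuous f := CompactSpace.uniformContinuous_of_continuous f.continuous
    obtain ⟨r, hr0, hr⟩ := Metric.uniformContinuous_iff.1 huc η hη
    filter_upwards [Ioo_mem_nhdsGT hr0] with δ hδ y z hyz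
    have := hr (hyz.trans_lt hδ.2)
    rw [Real.dist_eq] at this
    linarith [le_abs_self (f y - f z)]
  have h1' : ∀ᶠ δ : ℝ in 𝓝[>] 0, ∀ j j' y z, y ∈ K j → z ∈ K j' → dist y z ≤ 2 * δ → j = j' :=
    eventually_all.2 fun j => eventually_all.2 fun j' => h1 j j'
  obtain ⟨δ, hδ1, hδ2, hδ0⟩ := (h1'.and (h2.and self_mem_nhdsWithin)).exists
  refine ⟨K, _, δ, hU, fun y hy => ?_, hμU, hδ0, hδ1, hδ2⟩
  by_contra hyK
  exact hy (mem_iUnion.2 ⟨code y, rfl, hyK⟩)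

section Ergodic

open ProbabilityTheory

variable [MetricSpace X] [CompactSpace X] [MeasurableSpace X] [BorelSpace X] {T : X ≃ₜ X}
  {μ : Measure X} [IsProbabilityMeasure μ] {ι : Type*} [Fintype ι] [MeasurableSpace ι]
  [MeasurableSingletonClass ι]

omit [CompactSpace X] [IsProbabilityMeasure μ] in
lemma measurePreserving_symm_iterate (hT : MeasurePreserving T μ μ) (n : ℕ) :
    MeasurePreserving (T.symm^[n]) μ μ :=
  (MeasurePreserving.symm T.toMeasurableEquiv hT).iterate n

omit [CompactSpace X] in
/-- A set of positive measure is visited by almost every backward orbit. -/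
lemma ae_exists_symm_iterate_mem (hT : Ergodic T μ) {D : Set X} (hD : MeasurableSet D)
    (h0 : μ D ≠ 0) : ∀ᵐ x ∂μ, ∃ N, T.symm^[N] x ∈ D := by
  have hS : Ergodic T.toMeasurableEquiv.symm μ :=
    Ergodic.symm (e := T.toMeasurableEquiv) hT
  have hmeas : MeasurableSet (⋃ N, T.symm^[N] ⁻¹' D) :=
    MeasurableSet.iUnion fun N =>
      (measurePreserving_symm_iterate hT.toMeasurePreserving N).measurable hD
  have hsub : T.toMeasurableEquiv.symm ⁻¹' (⋃ N, T.symm^[N] ⁻¹' D) ⊆ ⋃ N, T.symm^[N] ⁻¹' D := by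
    intro x hx
    obtain ⟨N, hN⟩ := mem_iUnion.1 hx
    exact mem_iUnion.2 ⟨N + 1, by rwa [mem_preimage, Function.iterate_succ_apply]⟩
  rcases hS.ae_empty_or_univ_of_preimage_ae_le hmeas.nullMeasurableSet
    hsub.eventuallyLE with h | h
  · exact absurd (measure_mono_null (subset_iUnion (fun N => T.symm^[N] ⁻¹' D) 0)
      (measure_congr h |>.trans measure_empty)) h0
  · filter_upwards [eventuallyEq_univ.1 h] with x hx using mem_iUnion.1 hx

lemma ae_le_pres_of_lt (hT : Ergodic T μ) (f : C(X, ℝ)) {code : X → ι} (hcode : Measurable code)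
    (κ : Kernel X X) [IsMarkovKernel κ]
    (hκ : ∀ g : X → ℝ, Integrable g μ → ∫ x, ∫ y, g y ∂(κ x) ∂μ = ∫ x, g x ∂μ) {A : X → Set X}
    (hA : ∀ᵐ x ∂μ, ∀ᵐ y ∂(κ x), y ∈ A x) (hTA : ∀ x, T '' A x ⊆ A (T x)) {c c' : ℝ}
    (hc : ∀ n : ℕ, n * c ≤ ∫ x, ent (κ x) (fun y (i : Fin n) => code (T.symm^[i] y)) ∂μ)
    (hc' : c' < c + ∫ x, f x ∂μ) : ∀ᵐ x ∂μ, (c' : EReal) ≤ pres T.symm f (A x) := by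
  set gap := (c + ∫ x, f x ∂μ - c') / 8 with hgap
  have hg0 : 0 < gap := by rw [hgap]; linarith
  obtain ⟨θ, hθ0, hθ1, hθ⟩ : ∃ θ : ℝ, 0 < θ ∧ θ < 1 ∧ -gap < Real.log (1 - θ) := by
    have h1 : Tendsto (fun θ : ℝ => Real.log (1 - θ)) (𝓝[>] 0) (𝓝 0) := by
      have : ContinuousAt (fun θ : ℝ => Real.log (1 - θ)) 0 :=
        (continuousAt_const.sub continuousAt_id).log (by norm_num)
      have h := this.tendsto
      simp only [sub_zero, Real.log_one] at h
      exact h.mono_left nhdsWithin_le_nhds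
    obtain ⟨θ, h2, h3⟩ := ((h1.eventually (lt_mem_nhds (neg_lt_zero.2 hg0))).and
      (Ioo_mem_nhdsGT zero_lt_one)).exists
    exact ⟨θ, h3.1, h3.2, h2⟩
  set l := Real.log (Fintype.card ι / θ) with hl
  obtain ⟨K, U, δ, hU, hKU, hμU, hδ, hK, hf⟩ := exists_compact_approx μ f hcode
    (ε := gap / (|l| + 1)) (η := gap) (by positivity) hg0
  have hlU : l * μ.real U ≤ gap := by
    calc l * μ.real U ≤ |l| * (gap / (|l| + 1)) :=
          mul_le_mul (le_abs_self l) hμU measureReal_nonneg (abs_nonneg l)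
      _ ≤ gap := by
          rw [mul_div_assoc', div_le_iff₀ (by positivity)]
          nlinarith
  obtain ⟨x₀⟩ : Nonempty X := μ.nonempty_of_neZero
  have hι : Nonempty ι := ⟨code x₀⟩
  have hSc : Continuous T.symm := T.symm.continuous
  have hSm : ∀ i, Measurable (T.symm^[i]) := fun i => (hSc.iterate i).measurable
  have hC : ∀ x, |f x| ≤ ‖f‖ := fun x => f.norm_coe_le_norm x
  have hbc : ∀ n, Continuous (birk T.symm f n) := fun n =>
    continuous_finsetSum _ fun i _ => f.continuous.comp (hSc.iterate i)
  have hword : ∀ n, Measurable fun y (i : Fin n) => code (T.symm^[i] y) := fun n =>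
    measurable_pi_lambda _ fun i => hcode.comp (hSm i)
  have hme : ∀ n, Measurable fun x => ent (κ x) (fun y (i : Fin n) => code (T.symm^[i] y)) :=
    fun n => Finset.measurable_sum _ fun b _ => Real.continuous_negMulLog.measurable.comp
      (κ.measurable_coe (hword n (measurableSet_singleton b))).ennreal_toReal
  have hmb : ∀ n, Measurable fun x => ∫ y, birk T.symm f n y ∂(κ x) := fun n =>
    ((hbc n).stronglyMeasurable.integral_kernel).measurable
  have hmU : ∀ n, Measurable fun x => ∑ i ∈ Finset.range n, (κ x).real (T.symm^[i] ⁻¹' U) :=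
    fun n => Finset.measurable_sum _ fun i _ => (κ.measurable_coe (hSm i hU)).ennreal_toReal
  set L : ℕ → X → ℝ := fun n x => ent (κ x) (fun y (i : Fin n) => code (T.symm^[i] y)) +
    ∫ y, birk T.symm f n y ∂(κ x) -
      l * ∑ i ∈ Finset.range n, (κ x).real (T.symm^[i] ⁻¹' U) with hL
  have hLm : ∀ n, Measurable (L n) := fun n => ((hme n).add (hmb n)).sub ((hmU n).const_mul l)
  have be : ∀ n x, |ent (κ x) (fun y (i : Fin n) => code (T.symm^[i] y))| ≤
      n * Real.log (Fintype.card ι) := fun n x =>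
    abs_ent_word_le fun b => hword n (measurableSet_singleton b)
  have bb : ∀ n x, |∫ y, birk T.symm f n y ∂(κ x)| ≤ n * ‖f‖ := fun n x => by
    have := norm_integral_le_of_norm_le_const (μ := κ x) (f := birk T.symm f n) (C := n * ‖f‖)
      (ae_of_all _ fun y => abs_birk_le (S := T.symm) hC n y)
    simpa using this
  have bU : ∀ n x, |∑ i ∈ Finset.range n, (κ x).real (T.symm^[i] ⁻¹' U)| ≤ n := fun n x => by
    rw [abs_of_nonneg (Finset.sum_nonneg fun _ _ => measureReal_nonneg)]
    refine (Finset.sum_le_sum fun i _ => measureReal_le_one).trans ?_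
    simp
  have hLb : ∀ n x, |L n x| ≤ n * (Real.log (Fintype.card ι) + ‖f‖ + |l|) := by
    intro n x
    refine (abs_sub _ _).trans ?_
    have h1 := abs_add_le (ent (κ x) (fun y (i : Fin n) => code (T.symm^[i] y)))
      (∫ y, birk T.symm f n y ∂(κ x))
    have h2 : |l * ∑ i ∈ Finset.range n, (κ x).real (T.symm^[i] ⁻¹' U)| ≤ |l| * n := by
      rw [abs_mul]; exact mul_le_mul_of_nonneg_left (bU n x) (abs_nonneg l)
    linarith [be n x, bb n x]
  have hfi : ∀ i, Integrable (fun x => f (T.symm^[i] x)) μ := fun i =>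
    Integrable.of_bound (f.continuous.comp (hSc.iterate i)).measurable.aestronglyMeasurable ‖f‖
      (ae_of_all _ fun x => hC _)
  have hSp := measurePreserving_symm_iterate hT.toMeasurePreserving
  have hLint : ∀ n : ℕ, n * (c + ∫ x, f x ∂μ - gap) ≤ ∫ x, L n x ∂μ := by
    intro n
    have i1 : Integrable (fun x => ent (κ x) (fun y (i : Fin n) => code (T.symm^[i] y))) μ :=
      Integrable.of_bound (hme n).aestronglyMeasurable _ (ae_of_all _ (be n))
    have i2 : Integrable (fun x => ∫ y, birk T.symm f n y ∂(κ x)) μ :=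
      Integrable.of_bound (hmb n).aestronglyMeasurable _ (ae_of_all _ (bb n))
    have i3 : ∀ i ∈ Finset.range n, Integrable (fun x => (κ x).real (T.symm^[i] ⁻¹' U)) μ :=
      fun i _ => Integrable.of_bound
        (κ.measurable_coe (hSm i hU)).ennreal_toReal.aestronglyMeasurable 1
        (ae_of_all _ fun x => by
          rw [Real.norm_of_nonneg measureReal_nonneg]; exact measureReal_le_one)
    have i12 : Integrable (fun x => ent (κ x) (fun y (i : Fin n) => code (T.symm^[i] y)) +
      ∫ y, birk T.symm f n y ∂(κ x)) μ := i1.add i2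
    rw [hL]; simp only
    rw [integral_sub i12 ((integrable_finsetSum _ i3).const_mul l), integral_add i1 i2,
      integral_const_mul, integral_finsetSum _ i3, hκ _ (Integrable.of_bound
        (hbc n).measurable.aestronglyMeasurable _ (ae_of_all _ fun x => abs_birk_le hC n x))]
    have e1 : ∫ x, birk T.symm f n x ∂μ = n * ∫ x, f x ∂μ := by
      simp only [birk]
      rw [integral_finsetSum _ fun i _ => hfi i]
      have : ∀ i ∈ Finset.range n, ∫ x, f (T.symm^[i] x) ∂μ = ∫ x, f x ∂μ := fun i _ => by
        rw [← integral_map (hSm i).aemeasurable f.continuous.measurable.aestronglyMeasurable,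
          (hSp i).map_eq]
      rw [Finset.sum_congr rfl this]
      simp
    have e2 : ∀ i ∈ Finset.range n, ∫ x, (κ x).real (T.symm^[i] ⁻¹' U) ∂μ = μ.real U := by
      intro i _
      have h1 := hκ ((T.symm^[i] ⁻¹' U).indicator fun _ => (1 : ℝ))
        ((integrable_const (1 : ℝ)).indicator (hSm i hU))
      simp only [integral_indicator (hSm i hU), setIntegral_const, smul_eq_mul, mul_one] at h1
      rw [h1, (hSp i).measureReal_preimage hU.nullMeasurableSet]
    rw [e1, Finset.sum_congr rfl e2]
    simp only [Finset.sum_const, Finset.card_range, nsmul_eq_mul]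
    have h1 := hc n
    have h2 : (n : ℝ) * (l * μ.real U) ≤ n * gap := by gcongr
    linarith
  have hnot := not_ae_eventually_lt hLm hLb hLint
    (c' := c + ∫ x, f x ∂μ - 2 * gap) (by linarith)
  set D : Set X := {x | ∃ᶠ n : ℕ in atTop, n * (c + ∫ x, f x ∂μ - 2 * gap) ≤ L n x} with hD
  have hDm : MeasurableSet D := by
    have : D = ⋂ a : ℕ, ⋃ b : ℕ, ⋃ _ : a ≤ b, {x | b * (c + ∫ x, f x ∂μ - 2 * gap) ≤ L b x} := by
      ext x; simp [hD, frequently_atTop]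
    rw [this]
    exact MeasurableSet.iInter fun a => MeasurableSet.iUnion fun b => MeasurableSet.iUnion fun _ =>
      measurableSet_le measurable_const (hLm b)
  have hD0 : μ D ≠ 0 := by
    intro h0
    refine hnot ?_
    filter_upwards [measure_eq_zero_iff_ae_notMem.1 h0] with x hx
    simpa only [hD, mem_ofPred_eq, not_frequently, not_le] using hx
  have hgood : ∀ᵐ x ∂μ, ∀ N, ∀ᵐ y ∂(κ (T.symm^[N] x)), y ∈ A (T.symm^[N] x) :=
    ae_all_iff.2 fun N => (hSp N).quasiMeasurePreserving.ae hA
  filter_upwards [ae_exists_symm_iterate_mem hT hDm hD0, hgood] with x hx hgx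
  obtain ⟨N, hN⟩ := hx
  have hAN := hgx N
  set z := T.symm^[N] x with hz
  have hTz : T^[N] z = x := by
    rw [hz]; exact (Function.LeftInverse.iterate (f := T.symm) (g := T) T.apply_symm_apply N) x
  have hTAN : ∀ (k : ℕ) w, T^[k] '' A w ⊆ A (T^[k] w) := by
    intro k
    induction k with
    | zero => intro w; simp
    | succ k ih =>
      intro w
      rw [Function.iterate_succ', Set.image_comp]
      exact (Set.image_mono (ih w)).trans (hTA _)
  have hsub : T^[N] '' A z ⊆ A x := by simpa only [hTz] using hTAN N z
  have hfr : ∃ᶠ n : ℕ in atTop, Real.exp ((n + N : ℕ) * c') ≤ sepPn T.symm f (n + N) δ (A x) := by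
    have hev : ∀ᶠ n : ℕ in atTop, N * ‖f‖ + N * c' ≤ n * gap :=
      (tendsto_natCast_atTop_atTop.atTop_mul_const hg0).eventually_ge_atTop _
    refine (hN.and_eventually hev).mono ?_
    rintro n ⟨hn, hn'⟩
    have h1 := exp_le_sepPn (n := n) hSc hcode hU hKU hδ hK hf hθ0 hθ1 hAN
    refine le_trans ?_ (sepPn_mono_image hSc T.symm_apply_apply hC hδ N n hsub)
    refine le_trans ?_ (mul_le_mul_of_nonneg_left h1 (Real.exp_pos _).le)
    rw [← Real.exp_add]
    refine Real.exp_le_exp.2 ?_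
    have h2 : (n : ℝ) * (gap - Real.log (1 - θ)) ≤ n * (2 * gap) := by
      gcongr; linarith
    have h3 : (n : ℝ) * (c + ∫ x, f x ∂μ - 2 * gap) = n * c' + n * (6 * gap) := by
      rw [hgap]; ring
    have h4 : 0 ≤ (n : ℝ) * gap := by positivity
    simp only [hL] at hn
    push_cast
    linarith
  refine le_pres_of_frequently hδ ?_
  rw [frequently_atTop] at hfr ⊢
  intro a
  obtain ⟨b, hb, h⟩ := hfr a
  exact ⟨b + N, by omega, h⟩

/-- If the fibre measures `κ x` live on `A x` and have mean word entropies growing at rate at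
least `c`, then almost every `A x` carries the pressure `c + ∫ f`. -/
theorem ae_le_pres (hT : Ergodic T μ) (f : C(X, ℝ)) {code : X → ι} (hcode : Measurable code)
    (κ : Kernel X X) [IsMarkovKernel κ]
    (hκ : ∀ g : X → ℝ, Integrable g μ → ∫ x, ∫ y, g y ∂(κ x) ∂μ = ∫ x, g x ∂μ) {A : X → Set X}
    (hA : ∀ᵐ x ∂μ, ∀ᵐ y ∂(κ x), y ∈ A x) (hTA : ∀ x, T '' A x ⊆ A (T x)) {c : ℝ}
    (hc : ∀ n : ℕ, n * c ≤ ∫ x, ent (κ x) (fun y (i : Fin n) => code (T.symm^[i] y)) ∂μ) :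
    ∀ᵐ x ∂μ, ((c + ∫ x, f x ∂μ : ℝ) : EReal) ≤ pres T.symm f (A x) := by
  have h : ∀ k : ℕ, ∀ᵐ x ∂μ,
      ((c + ∫ x, f x ∂μ - 1 / (k + 1 : ℝ) : ℝ) : EReal) ≤ pres T.symm f (A x) := fun k =>
    ae_le_pres_of_lt hT f hcode κ hκ hA hTA hc
      (sub_lt_self _ (by positivity))
  filter_upwards [ae_all_iff.2 h] with x hx
  have hlim : Tendsto (fun k : ℕ => ((c + ∫ x, f x ∂μ - 1 / (k + 1 : ℝ) : ℝ) : EReal)) atTop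
      (𝓝 ((c + ∫ x, f x ∂μ : ℝ) : EReal)) := by
    refine (continuous_coe_real_ereal.tendsto _).comp ?_
    simpa using (tendsto_const_nhds (x := c + ∫ x, f x ∂μ)).sub
      (tendsto_one_div_add_atTop_nhds_zero_nat (𝕜 := ℝ))
  exact le_of_tendsto' hlim hx

end Ergodic

section Bits

variable [TopologicalSpace X]

open Classical in
/-- Whether the orbit of `x` lies in `B i` at time `t + 1`, for `s = (i, t)`. -/
def bit (T : X ≃ₜ X) (B : ℕ → Set X) (s : ℕ × ℤ) (x : X) : Bool :=
  decide ((T ^ (s.2 + 1)) x ∈ B s.1)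

lemma bit_eq_bit {T : X ≃ₜ X} {B : ℕ → Set X} {s : ℕ × ℤ} {x y : X} :
    bit T B s x = bit T B s y ↔ ((T ^ (s.2 + 1)) x ∈ B s.1 ↔ (T ^ (s.2 + 1)) y ∈ B s.1) := by
  simp [bit]

lemma bit_add_one (T : X ≃ₜ X) (B : ℕ → Set X) (i : ℕ) (t : ℤ) (x : X) :
    bit T B (i, t + 1) x = bit T B (i, t) (T x) := by
  simp only [bit]
  rw [zpow_add_one, Homeomorph.mul_apply]

lemma zpow_natCast_apply (T : X ≃ₜ X) (n : ℕ) (x : X) : (T ^ (n : ℤ)) x = T^[n] x := by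
  induction n generalizing x with
  | zero => simp
  | succ n ih => rw [Nat.cast_succ, zpow_add_one, Homeomorph.mul_apply, ih]; rfl

lemma zpow_neg_natCast_apply (T : X ≃ₜ X) (n : ℕ) (x : X) :
    (T ^ (-(n : ℤ))) x = T.symm^[n] x := by
  rw [zpow_neg, ← inv_zpow, zpow_natCast_apply]; rfl

variable [MeasurableSpace X] [BorelSpace X] {T : X ≃ₜ X} {B : ℕ → Set X}

lemma measurable_bit (hB : ∀ i, MeasurableSet (B i)) (s : ℕ × ℤ) : Measurable (bit T B s) := by
  refine measurable_to_bool ?_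
  have : bit T B s ⁻¹' {true} = (T ^ (s.2 + 1)) ⁻¹' B s.1 := by ext x; simp [bit]
  rw [this]
  exact (T ^ (s.2 + 1)).continuous.measurable (hB _)

/-- The joint entropy of finitely many bits. -/
def bitEnt (μ : Measure X) (T : X ≃ₜ X) (B : ℕ → Set X) (S : Finset (ℕ × ℤ)) : ℝ :=
  ent μ fun x (s : S) => bit T B s x

variable {μ : Measure X}

lemma measurableSet_bits (hB : ∀ i, MeasurableSet (B i)) (S : Finset (ℕ × ℤ)) (b : S → Bool) :
    MeasurableSet ((fun x (s : S) => bit T B s x) ⁻¹' {b}) :=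
  measurable_pi_lambda (fun x (s : S) => bit T B s x) (fun s => measurable_bit hB s)
    (measurableSet_singleton b)

section

variable [IsProbabilityMeasure μ] {β : Type*} [Fintype β]

omit [BorelSpace X] in
lemma bitEnt_le {S : Finset (ℕ × ℤ)} {Y : X → β} (hY : ∀ b, MeasurableSet (Y ⁻¹' {b}))
    (h : ∀ x y, Y x = Y y → ∀ s ∈ S, bit T B s x = bit T B s y) : bitEnt μ T B S ≤ ent μ Y :=
  ent_le_of_determined hY fun x y hxy => funext fun s => h x y hxy s s.2

lemma le_bitEnt (hB : ∀ i, MeasurableSet (B i)) {S : Finset (ℕ × ℤ)} {Y : X → β}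
    (h : ∀ x y, (∀ s ∈ S, bit T B s x = bit T B s y) → Y x = Y y) : ent μ Y ≤ bitEnt μ T B S :=
  ent_le_of_determined (measurableSet_bits hB S) fun x y hxy => h x y fun s hs =>
    congrFun hxy ⟨s, hs⟩

lemma bitEnt_map_timeShift_one (hT : MeasurePreserving T μ μ) (hB : ∀ i, MeasurableSet (B i))
    (S : Finset (ℕ × ℤ)) : bitEnt μ T B (S.map (timeShift 1).toEmbedding) = bitEnt μ T B S := by
  have h : bitEnt μ T B S = ent μ ((fun x (s : S) => bit T B s x) ∘ T) :=
    (ent_comp (measurableSet_bits hB S) hT).symm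
  rw [h]
  refine le_antisymm (bitEnt_le ?_ ?_) (le_bitEnt hB ?_)
  · exact fun b => T.continuous.measurable (measurableSet_bits hB S b)
  · rintro x y hxy ⟨i, t⟩ hs
    have := congrFun hxy ⟨_, mem_map_timeShift.1 hs⟩
    simp only [Function.comp_apply, ← bit_add_one, sub_add_cancel] at this
    exact this
  · refine fun x y hxy => funext fun ⟨⟨i, t⟩, hs⟩ => ?_
    simp only [Function.comp_apply, ← bit_add_one]
    exact hxy _ (mem_map_timeShift.2 (by simpa using hs))

lemma isEntropyFn_bitEnt (hT : MeasurePreserving T μ μ) (hB : ∀ i, MeasurableSet (B i)) :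
    IsEntropyFn (bitEnt μ T B) where
  empty := by
    refine le_antisymm ?_ (ent_nonneg _)
    calc bitEnt μ T B ∅ ≤ ent μ (fun _ : X => ()) :=
          bitEnt_le (fun _ => by simp) (by simp)
      _ = 0 := by simp [ent]
  mono C D h := bitEnt_le (measurableSet_bits hB D) fun x y hxy s hs => congrFun hxy ⟨s, h hs⟩
  submod C D := by
    have hm := measurableSet_bits (T := T) hB
    refine le_trans ?_ ((ent_submod (μ := μ) (W := fun x (s : ↥(C ∩ D)) => bit T B s x)
      (hm C) (hm D)).trans ?_)
    · refine add_le_add_left (bitEnt_le (measurableSet_pair (hm C)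
        (measurableSet_pair (hm D) (hm (C ∩ D)))) fun x y hxy s hs => ?_) _
      rw [Prod.ext_iff, Prod.ext_iff] at hxy
      rcases Finset.mem_union.1 hs with h | h
      · exact congrFun hxy.1 ⟨s, h⟩
      · exact congrFun hxy.2.1 ⟨s, h⟩
    · refine add_le_add (le_bitEnt hB fun x y hxy => ?_) (le_bitEnt hB fun x y hxy => ?_)
      · exact Prod.ext (funext fun s => hxy s s.2)
          (funext fun s => hxy s (Finset.mem_inter.1 s.2).1)
      · exact Prod.ext (funext fun s => hxy s s.2)
          (funext fun s => hxy s (Finset.mem_inter.1 s.2).2)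
  shift t S := by
    have hadd : ∀ (a b : ℤ) (S : Finset (ℕ × ℤ)), (S.map (timeShift a).toEmbedding).map
        (timeShift b).toEmbedding = S.map (timeShift (a + b)).toEmbedding := by
      intro a b S; ext s; simp only [mem_map_timeShift]; rw [sub_sub, add_comm a]
    induction t generalizing S with
    | zero =>
      congr 1; ext s; simp only [mem_map_timeShift, sub_zero]
    | succ n ih => rw [← hadd, bitEnt_map_timeShift_one hT hB, ih]
    | pred n ih =>
      rw [← bitEnt_map_timeShift_one hT hB, hadd, sub_add_cancel, ih]

omit [BorelSpace X] [IsProbabilityMeasure μ] in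
lemma exists_dynH_eq_ent {α : Finset (Set X)} (hα : IsFinPartition α) :
    ∃ name : X → α, (∀ x (a : α), name x = a ↔ x ∈ (a : Set X)) ∧
      ∀ n, dynH μ T α n = ent μ fun x (i : Fin n) => name (T^[i] x) := by
  have hex : ∀ x, ∃ a : α, x ∈ (a : Set X) := fun x => by
    have : x ∈ ⋃₀ (α : Set (Set X)) := hα.2.1 ▸ mem_univ x
    obtain ⟨a, ha, hx⟩ := this
    exact ⟨⟨a, ha⟩, hx⟩
  choose name hname using hex
  have key : ∀ x (a : α), name x = a ↔ x ∈ (a : Set X) := by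
    refine fun x a => ⟨fun h => h ▸ hname x, fun h => ?_⟩
    by_contra hne
    exact disjoint_left.1 (hα.2.2 (name x).2 a.2 fun h => hne (Subtype.ext h)) (hname x) h
  refine ⟨name, key, fun n => Finset.sum_congr rfl fun g _ => ?_⟩
  congr 3
  ext x
  simp only [mem_iInter, mem_preimage, mem_singleton_iff, funext_iff, key]

lemma entPart_le_rowRate (hT : MeasurePreserving T μ μ) (hB : ∀ i, MeasurableSet (B i))
    {α : Finset (Set X)} (hα : IsFinPartition α) {m : ℕ} (h : ∀ a ∈ α, ∃ j ≤ m, B j = a) :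
    entPart μ T α ≤ rowRate (bitEnt μ T B) m := by
  have hF := isEntropyFn_bitEnt hT hB
  obtain ⟨name, hname, hdyn⟩ := exists_dynH_eq_ent (μ := μ) (T := T) hα
  have hle : ∀ n : ℕ, dynH μ T α n ≤ bitEnt μ T B (seg (row m) n) := by
    intro n
    rw [hdyn, ← hF.shift (n - 1)]
    refine le_bitEnt hB fun x y hxy => funext fun i => ?_
    obtain ⟨j, hj, hBj⟩ := h _ (name (T^[i] x)).2
    have hmem : ((j, (i : ℤ) - 1) : ℕ × ℤ) ∈
        (seg (row m) n).map (timeShift ((n : ℤ) - 1)).toEmbedding := by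
      refine mem_map_timeShift.2 (mem_seg.2 ⟨n - 1 - i, by omega, mem_row.2 ⟨hj, ?_⟩⟩)
      dsimp only
      omega
    have h1 := bit_eq_bit.1 (hxy _ hmem)
    simp only [sub_add_cancel, zpow_natCast_apply, hBj] at h1
    exact ((hname _ _).2 (h1.1 ((hname _ _).1 rfl))).symm
  refine ge_of_tendsto' ((tendsto_add_atTop_iff_nat 1).2 (hF.tendsto_seg_div (row m))) fun n => ?_
  refine (ciInf_le ⟨0, ?_⟩ n).trans ?_
  · rintro _ ⟨k, rfl⟩
    dsimp only
    rw [hdyn]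
    exact div_nonneg (ent_nonneg _) (by positivity)
  · push_cast
    gcongr
    exact hle (n + 1)

end

end Bits

section StableFibre

variable [MetricSpace X] [CompactSpace X]

/-- The closure of the points whose bits indexed by `G` agree with those of `x`. -/
def bitFibre (T : X ≃ₜ X) (B : ℕ → Set X) (G : Set (ℕ × ℤ)) (x : X) : Set X :=
  closure {y | ∀ s ∈ G, bit T B s y = bit T B s x}

variable {T : X ≃ₜ X} {B : ℕ → Set X} {G : Set (ℕ × ℤ)}

omit [CompactSpace X] in
lemma image_bitFibre_subset (hG : ∀ s ∈ G, (s.1, s.2 + 1) ∈ G) (x : X) :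
    T '' bitFibre T B G x ⊆ bitFibre T B G (T x) := by
  refine (image_closure_subset_closure_image T.continuous).trans (closure_mono ?_)
  rintro _ ⟨y, hy, rfl⟩ s hs
  rw [← bit_add_one, ← bit_add_one]
  exact hy _ (hG s hs)

lemma tendsto_diam_bitFibre (hB : ∀ U ∈ TopologicalSpace.countableBasis X, ∃ i, B i = U)
    (hG : ∀ i, ∃ k : ℕ, ∀ t : ℤ, k ≤ t → (i, t) ∈ G) (x : X) :
    Tendsto (fun n : ℕ => Metric.diam (T^[n] '' bitFibre T B G x)) atTop (𝓝 0) := by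
  rw [Metric.tendsto_atTop]
  intro ε hε
  have hcov : ∀ z : X, ∃ i, z ∈ B i ∧ IsOpen (B i) ∧ B i ⊆ Metric.ball z (ε / 4) := by
    intro z
    have hb := TopologicalSpace.isBasis_countableBasis X
    obtain ⟨U, hU, hzU, hUz⟩ := hb.exists_subset_of_mem_open
      (Metric.mem_ball_self (by positivity : 0 < ε / 4)) Metric.isOpen_ball
    obtain ⟨i, rfl⟩ := hB U hU
    exact ⟨i, hzU, hb.isOpen hU, hUz⟩
  choose i hi hio hib using hcov
  choose k hk using hG
  obtain ⟨I, hI⟩ := isCompact_univ.elim_finite_subcover (fun z => B (i z)) hio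
    fun z _ => mem_iUnion.2 ⟨z, hi z⟩
  refine ⟨I.sup (fun z => k (i z)) + 1, fun n hn => ?_⟩
  have hd : Metric.diam (T^[n] '' bitFibre T B G x) ≤ ε / 2 := by
    refine (Metric.diam_mono (image_closure_subset_closure_image (T.continuous.iterate n))
      (Metric.isBounded_of_compactSpace)).trans ?_
    rw [Metric.diam_closure]
    refine Metric.diam_le_of_forall_dist_le (by positivity) ?_
    rintro _ ⟨y, hy, rfl⟩ _ ⟨z, hz, rfl⟩
    obtain ⟨w, hw, hyw⟩ := mem_iUnion₂.1 (hI (mem_univ (T^[n] y)))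
    have hkw : k (i w) ≤ I.sup fun z => k (i z) := Finset.le_sup (f := fun z => k (i z)) hw
    have hs : ((i w, (n : ℤ) - 1) : ℕ × ℤ) ∈ G := hk _ _ (by omega)
    have h1 := bit_eq_bit.1 ((hy _ hs).trans (hz _ hs).symm)
    simp only [sub_add_cancel, zpow_natCast_apply] at h1
    have h2 := Metric.mem_ball.1 (hib w hyw)
    have h3 := Metric.mem_ball.1 (hib w (h1.1 hyw))
    linarith [dist_triangle_right (T^[n] y) (T^[n] z) w]
  rw [Real.dist_eq, sub_zero, abs_of_nonneg Metric.diam_nonneg]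
  linarith

lemma bitFibre_subset_stableSet (hB : ∀ U ∈ TopologicalSpace.countableBasis X, ∃ i, B i = U)
    (hG : ∀ i, ∃ k : ℕ, ∀ t : ℤ, k ≤ t → (i, t) ∈ G) (x : X) :
    bitFibre T B G x ⊆ stableSet T x := by
  intro y hy
  have hx : x ∈ bitFibre T B G x := subset_closure fun _ _ => rfl
  exact squeeze_zero (fun _ => dist_nonneg) (fun n => Metric.dist_le_diam_of_mem
    Metric.isBounded_of_compactSpace (mem_image_of_mem _ hx) (mem_image_of_mem _ hy))
    (tendsto_diam_bitFibre hB hG x)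

variable [MeasurableSpace X] [BorelSpace X] {μ : Measure X} [IsProbabilityMeasure μ]

open ProbabilityTheory in
lemma ae_rowRate_le_pres (hT : Ergodic T μ) (f : C(X, ℝ)) (hB : ∀ i, MeasurableSet (B i))
    (hG1 : ∀ s ∈ G, (s.1, s.2 + 1) ∈ G) (hGne : G.Nonempty) {m : ℕ} {c : ℝ}
    (hG : ∀ n : ℕ, n * c ≤ condF (bitEnt μ T B) (seg (row m) n) G) :
    ∀ᵐ x ∂μ, ((c + ∫ x, f x ∂μ : ℝ) : EReal) ≤ pres T.symm f (bitFibre T B G x) := by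
  classical
  have hF := isEntropyFn_bitEnt hT.toMeasurePreserving hB
  obtain ⟨e, he⟩ := G.to_countable.exists_eq_range hGne
  set V : ℕ → X → Bool := fun i => bit T B (e i) with hVdef
  have hV : ∀ i, Measurable (V i) := fun i => measurable_bit hB _
  have hle := bitSigma_le V hV
  set κ : Kernel X X := (condExpKernel μ (bitSigma V hV)).comap id (measurable_id'' hle) with hκdef
  have hκ : ∀ x, κ x = condExpKernel μ (bitSigma V hV) x := fun x => rfl
  set code : X → Fin (m + 1) → Bool := fun x j => bit T B (j, -1) x with hcode
  have hcm : Measurable code := measurable_pi_lambda _ fun j => measurable_bit hB _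
  have hSm : ∀ i, Measurable (T.symm^[i]) := fun i => (T.symm.continuous.iterate i).measurable
  have hbit : ∀ i j y, bit T B (j, -1) (T.symm^[i] y) = bit T B (j, -1 - (i : ℤ)) y := by
    intro i j y
    simp only [bit, neg_add_cancel, zpow_zero, Homeomorph.one_apply]
    rw [show (-1 - (i : ℤ) + 1) = -(i : ℤ) by ring, zpow_neg_natCast_apply]
  refine ae_le_pres hT f hcm κ (fun g hg => ?_) ?_ (image_bitFibre_subset hG1) fun n => ?_
  · rw [← integral_condExp hle (f := g)]
    exact integral_congr_ae (condExp_ae_eq_integral_condExpKernel hle hg).symm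
  · filter_upwards [condExpKernel_same_bits (μ := μ) V hV] with x hx
    rw [hκ]
    filter_upwards [hx] with y hy
    refine subset_closure fun s hs => ?_
    obtain ⟨i, rfl⟩ := he ▸ hs
    exact hy i
  · simp only [hκ]
    have hword : Measurable fun y (i : Fin n) => code (T.symm^[i] y) :=
      measurable_pi_lambda _ fun i => hcm.comp (hSm i)
    refine le_integral_ent_condExpKernel V hV (fun b => hword (measurableSet_singleton b))
      fun l => ?_
    set C : Finset (ℕ × ℤ) := (Finset.range l).image e with hC
    have hCG : (C : Set (ℕ × ℤ)) ⊆ G := by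
      rw [he, hC, Finset.coe_image]; exact image_subset_range _ _
    have hVm : Measurable fun x (i : Fin l) => V i x := measurable_pi_lambda _ fun i => hV i
    have h1 : bitEnt μ T B (seg (row m) n ∪ C) ≤
        ent μ (fun x => ((fun i : Fin n => code (T.symm^[i] x)), fun i : Fin l => V i x)) := by
      refine bitEnt_le (measurableSet_pair (fun b => hword (measurableSet_singleton b))
        fun b => hVm (measurableSet_singleton b)) fun x y hxy s hs => ?_
      rw [Prod.ext_iff] at hxy
      rcases Finset.mem_union.1 hs with h | h
      · obtain ⟨i, hi, hr⟩ := mem_seg.1 h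
        obtain ⟨hj, ht⟩ := mem_row.1 hr
        have h2 := congrFun (congrFun hxy.1 ⟨i, hi⟩) ⟨s.1, Nat.lt_succ_of_le hj⟩
        simp only [hcode, hbit] at h2
        have hs' : s = (s.1, -1 - (i : ℤ)) := Prod.ext rfl (by dsimp only at ht ⊢; omega)
        rwa [hs']
      · obtain ⟨i, hi, rfl⟩ := Finset.mem_image.1 h
        exact congrFun hxy.2 ⟨i, Finset.mem_range.1 hi⟩
    have h2 : ent μ (fun x (i : Fin l) => V i x) ≤ bitEnt μ T B C :=
      le_bitEnt hB fun x y hxy => funext fun i =>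
        hxy _ (Finset.mem_image_of_mem e (Finset.mem_range.2 i.2))
    have h3 := (hG n).trans (hF.condF_le hCG)
    linarith

omit [MetricSpace X] [CompactSpace X] [BorelSpace X] in
lemma exists_seq_entPart (μ : Measure X) (T : X → X) : ∃ u : ℕ → Finset (Set X),
    (∀ k, IsFinPartition (u k)) ∧
    Tendsto (fun k => ((entPart μ T (u k) : ℝ) : EReal)) atTop (𝓝 (mEnt μ T)) := by
  have h := exists_seq_tendsto_sSup
    (S := (fun α => ((entPart μ T α : ℝ) : EReal)) '' {α | IsFinPartition α})
    ⟨_, mem_image_of_mem _ (show IsFinPartition ({univ} : Finset (Set X)) from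
      ⟨by simp, by simp, by simp⟩)⟩ (OrderTop.bddAbove _)
  obtain ⟨v, -, hv, hmem⟩ := h
  choose u hu huv using hmem
  refine ⟨u, hu, ?_⟩
  simp only [huv]
  rwa [sSup_image] at hv

/-- A sequence of Borel sets listing a countable basis and countably many partitions. -/
lemma exists_seq_sets {u : ℕ → Finset (Set X)} (hu : ∀ k, IsFinPartition (u k)) :
    ∃ B : ℕ → Set X, (∀ i, MeasurableSet (B i)) ∧
      (∀ U ∈ TopologicalSpace.countableBasis X, ∃ i, B i = U) ∧
      ∀ k, ∃ m, ∀ a ∈ u k, ∃ j ≤ m, B j = a := by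
  have hc : (insert univ
      (TopologicalSpace.countableBasis X ∪ ⋃ k, (u k : Set (Set X)))).Countable :=
    ((TopologicalSpace.countable_countableBasis X).union
      (countable_iUnion fun k => (u k).countable_toSet)).insert _
  obtain ⟨B, hB⟩ := hc.exists_eq_range (insert_nonempty _ _)
  refine ⟨B, fun i => ?_, fun U hU => ?_, fun k => ?_⟩
  · have h : B i ∈ range B := mem_range_self i
    rw [← hB] at h
    rcases h with h | h | h
    · rw [h]; exact MeasurableSet.univ
    · exact (TopologicalSpace.isOpen_of_mem_countableBasis h).measurableSet
    · obtain ⟨k, hk⟩ := mem_iUnion.1 h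
      exact (hu k).1 _ hk
  · have h : U ∈ range B := hB ▸ Or.inr (Or.inl hU)
    exact h
  · have h : ∀ a ∈ u k, ∃ j, B j = a := fun a ha => by
      have h : a ∈ range B := hB ▸ Or.inr (Or.inr (mem_iUnion.2 ⟨k, ha⟩))
      exact h
    choose! j hj using h
    exact ⟨(u k).sup j, fun a ha => ⟨j a, Finset.le_sup ha, hj a ha⟩⟩

end StableFibre

/-- For a TDS `(X,T)`, `f ∈ C(X,ℝ)` and an ergodic `T`-invariant
Borel probability measure `μ` with `h_μ(T) > 0`: for `μ`-a.e. `x` there is a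
closed `A(x) ⊆ W^s(x,T)` with `diam(TⁿA(x)) → 0` and `P(T⁻¹,f,A(x)) ≥ P_μ(T,f)`. -/
theorem stmt9 [MetricSpace X] [CompactSpace X] [MeasurableSpace X] [BorelSpace X]
    (T : X ≃ₜ X) (f : C(X, ℝ)) (μ : Measure X) [IsProbabilityMeasure μ]
    (herg : Ergodic ⇑T μ) (hpos : 0 < mEnt μ ⇑T) :
    ∀ᵐ x ∂μ, ∃ A : Set X, IsClosed A ∧ A ⊆ stableSet ⇑T x ∧
      Tendsto (fun n : ℕ => Metric.diam ((⇑T)^[n] '' A)) atTop (𝓝 0) ∧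
      mPres μ ⇑T ⇑f ≤ pres ⇑T.symm ⇑f A := by
  obtain ⟨u, hu, hlim⟩ := exists_seq_entPart μ T
  obtain ⟨B, hBm, hBbasis, hBu⟩ := exists_seq_sets hu
  have hF := isEntropyFn_bitEnt herg.toMeasurePreserving hBm
  obtain ⟨G, hG1, hG2, hG3⟩ := hF.exists_future
  have hGne : G.Nonempty := by
    obtain ⟨k, hk⟩ := hG2 0
    exact ⟨_, hk k le_rfl⟩
  filter_upwards [ae_all_iff.2 fun m => ae_rowRate_le_pres herg f hBm hG1 hGne (hG3 m)] with x hx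
  refine ⟨bitFibre T B G x, isClosed_closure, bitFibre_subset_stableSet hBbasis hG2 x,
    tendsto_diam_bitFibre hBbasis hG2 x, ?_⟩
  rw [mPres, ← EReal.le_sub_iff_add_le (Or.inl (EReal.coe_ne_bot _)) (Or.inl (EReal.coe_ne_top _))]
  refine le_of_tendsto' hlim fun k => ?_
  rw [EReal.le_sub_iff_add_le (Or.inl (EReal.coe_ne_bot _)) (Or.inl (EReal.coe_ne_top _)),
    ← EReal.coe_add]
  obtain ⟨M, hM⟩ := hBu k
  have hlim' : Tendsto (fun m : ℕ => ((entPart μ T (u k) - (1 / 2) ^ m + ∫ x, f x ∂μ : ℝ) : EReal))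
      atTop (𝓝 ((entPart μ T (u k) + ∫ x, f x ∂μ : ℝ) : EReal)) := by
    refine (continuous_coe_real_ereal.tendsto _).comp (Tendsto.add_const _ ?_)
    simpa using (tendsto_const_nhds (x := entPart μ T (u k))).sub
      (tendsto_pow_atTop_nhds_zero_of_lt_one (r := (1 / 2 : ℝ)) (by norm_num) (by norm_num))
  refine le_of_tendsto hlim' ?_
  filter_upwards [eventually_ge_atTop M] with m hm
  refine le_trans (EReal.coe_le_coe_iff.2 ?_) (hx m)
  have := entPart_le_rowRate herg.toMeasurePreserving hBm (hu k) (m := m) fun a ha => by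
    obtain ⟨j, hj, h⟩ := hM a ha
    exact ⟨j, hj.trans hm, h⟩
  gcongr
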